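/- arXiv:2512.12122 — 8 statements merged into one kernel-verified Lean document; each statement's English description precedes it below -/
import Mathlib

section
/- Let M ∈ ℝ^{d1×d2} with Frobenius norm ‖M‖_F = 1, and let a ∈ ℝ^{d1} and b ∈ ℝ^{d2} be unit vectors. Let â ∈ ℝ^{d1} be any unit vector with M Mᵀ â = ‖M‖₂² â (i.e., â is a top left singular vector of M). Then min( ‖â âᵀ − a aᵀ‖₂² , 1/2 ) ≤ ‖ vec(M) vec(M)ᵀ − vec(a bᵀ) vec(a bᵀ)ᵀ ‖₂². -/
open Matrix

/-- Spectral norm (ℓ₂→ℓ₂ operator norm) of a real matrix. -/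
noncomputable def sNorm {m n : Type*} [Fintype m] [Fintype n] [DecidableEq n]
    (M : Matrix m n ℝ) : ℝ :=
  ‖LinearMap.toContinuousLinearMap (Matrix.toEuclideanLin M)‖

/-- Frobenius norm of a real matrix. -/
noncomputable def frobNorm {m n : Type*} [Fintype m] [Fintype n] (M : Matrix m n ℝ) : ℝ :=
  Real.sqrt (∑ i, ∑ j, (M i j) ^ 2)

section SpectralNorm

variable {m n ι : Type*} [Fintype m] [Fintype n] [Fintype ι]

theorem norm_toLp_sq_eq_dotProduct (z : n → ℝ) : ‖WithLp.toLp 2 z‖ ^ 2 = z ⬝ᵥ z := by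
  rw [EuclideanSpace.real_norm_sq_eq]
  simp [dotProduct, sq]

theorem dotProduct_sq_le (u v : n → ℝ) : (u ⬝ᵥ v) ^ 2 ≤ (u ⬝ᵥ u) * (v ⬝ᵥ v) := by
  simpa [dotProduct, sq] using Finset.sum_mul_sq_le_sq_mul_sq Finset.univ u v

theorem mulVec_dotProduct_self_le_sNorm_sq [DecidableEq n] (M : Matrix m n ℝ) (z : n → ℝ) :
    (M *ᵥ z) ⬝ᵥ (M *ᵥ z) ≤ sNorm M ^ 2 * (z ⬝ᵥ z) := by
  have h := (LinearMap.toContinuousLinearMap (Matrix.toEuclideanLin M)).le_opNorm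
    (WithLp.toLp 2 z)
  have h' := pow_le_pow_left₀ (norm_nonneg _) h 2
  rw [mul_pow] at h'
  rw [← norm_toLp_sq_eq_dotProduct, ← norm_toLp_sq_eq_dotProduct]
  exact h'

theorem sNorm_sq_le_of_mulVec_le [DecidableEq n] (M : Matrix m n ℝ) {C : ℝ} (hC : 0 ≤ C)
    (h : ∀ z, (M *ᵥ z) ⬝ᵥ (M *ᵥ z) ≤ C * (z ⬝ᵥ z)) : sNorm M ^ 2 ≤ C := by
  have hle : sNorm M ≤ √C := by
    refine ContinuousLinearMap.opNorm_le_bound _ (Real.sqrt_nonneg C) fun z => ?_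
    refine (pow_le_pow_iff_left₀ (norm_nonneg _) (by positivity) two_ne_zero).mp ?_
    rw [mul_pow, Real.sq_sqrt hC]
    have hz := h z.ofLp
    rw [← norm_toLp_sq_eq_dotProduct, ← norm_toLp_sq_eq_dotProduct] at hz
    exact hz
  calc sNorm M ^ 2 ≤ √C ^ 2 := pow_le_pow_left₀ (norm_nonneg _) hle 2
    _ = C := Real.sq_sqrt hC

/-- The Cauchy–Schwarz inequality for the components of `v` and `z` orthogonal to a unit
vector `u`. -/
theorem dotProduct_orthogonal_component_sq_le (u v z : n → ℝ) (hu : u ⬝ᵥ u = 1) :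
    (v ⬝ᵥ z - (u ⬝ᵥ v) * (u ⬝ᵥ z)) ^ 2 ≤
      (v ⬝ᵥ v - (u ⬝ᵥ v) ^ 2) * (z ⬝ᵥ z - (u ⬝ᵥ z) ^ 2) := by
  have h := dotProduct_sq_le (v - (u ⬝ᵥ v) • u) (z - (u ⬝ᵥ z) • u)
  simp only [sub_dotProduct, dotProduct_sub, smul_dotProduct, dotProduct_smul, smul_eq_mul,
    hu, dotProduct_comm v u, dotProduct_comm z u] at h
  linarith

theorem vecMulVec_sub_mulVec_dotProduct_self (u v z : n → ℝ) (hu : u ⬝ᵥ u = 1)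
    (hv : v ⬝ᵥ v = 1) :
    ((vecMulVec u u - vecMulVec v v) *ᵥ z) ⬝ᵥ ((vecMulVec u u - vecMulVec v v) *ᵥ z) =
      (u ⬝ᵥ z) ^ 2 + (v ⬝ᵥ z) ^ 2 - 2 * (u ⬝ᵥ z) * (v ⬝ᵥ z) * (u ⬝ᵥ v) := by
  have h : (vecMulVec u u - vecMulVec v v) *ᵥ z = (u ⬝ᵥ z) • u - (v ⬝ᵥ z) • v := by
    simp [sub_mulVec, vecMulVec_mulVec]
  rw [h]
  simp only [sub_dotProduct, dotProduct_sub, smul_dotProduct, dotProduct_smul, smul_eq_mul,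
    hu, hv, dotProduct_comm v u]
  ring

theorem sNorm_vecMulVec_sub_sq [DecidableEq n] (u v : n → ℝ) (hu : u ⬝ᵥ u = 1)
    (hv : v ⬝ᵥ v = 1) :
    sNorm (vecMulVec u u - vecMulVec v v) ^ 2 = 1 - (u ⬝ᵥ v) ^ 2 := by
  apply le_antisymm
  · apply sNorm_sq_le_of_mulVec_le
    · have := dotProduct_sq_le u v
      rw [hu, hv] at this
      linarith
    · intro z
      rw [vecMulVec_sub_mulVec_dotProduct_self u v z hu hv]
      have := dotProduct_orthogonal_component_sq_le u v z hu
      rw [hv] at this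
      linarith
  · have := mulVec_dotProduct_self_le_sNorm_sq (vecMulVec u u - vecMulVec v v) u
    rw [vecMulVec_sub_mulVec_dotProduct_self u v u hu hv, hu, dotProduct_comm v u] at this
    linarith

theorem sum_dotProduct_col_self (M : Matrix m ι ℝ) :
    ∑ j, M.col j ⬝ᵥ M.col j = ∑ i, ∑ j, M i j ^ 2 := by
  rw [Finset.sum_comm]
  simp [dotProduct, sq]

theorem vecMul_dotProduct_self (M : Matrix m ι ℝ) (u : m → ℝ) :
    (u ᵥ* M) ⬝ᵥ (u ᵥ* M) = ∑ j, (u ⬝ᵥ M.col j) ^ 2 := by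
  simp only [dotProduct, vecMul, sq, Matrix.col_apply]

theorem vecMul_dotProduct_self_le (M : Matrix m ι ℝ) (u : m → ℝ) :
    (u ᵥ* M) ⬝ᵥ (u ᵥ* M) ≤ (u ⬝ᵥ u) * ∑ i, ∑ j, M i j ^ 2 := by
  rw [vecMul_dotProduct_self, ← sum_dotProduct_col_self, Finset.mul_sum]
  exact Finset.sum_le_sum fun j _ => dotProduct_sq_le u (M.col j)

/-- Bessel's inequality, summed over the columns of `M`, for the orthogonal pair `u`, `r`. -/
theorem vecMul_dotProduct_self_le_of_orthogonal (M : Matrix m ι ℝ) (u r : m → ℝ)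
    (hu : u ⬝ᵥ u = 1) (hur : u ⬝ᵥ r = 0) :
    (r ᵥ* M) ⬝ᵥ (r ᵥ* M) ≤
      (r ⬝ᵥ r) * (∑ i, ∑ j, M i j ^ 2 - (u ᵥ* M) ⬝ᵥ (u ᵥ* M)) := by
  rw [vecMul_dotProduct_self, vecMul_dotProduct_self, ← sum_dotProduct_col_self,
    ← Finset.sum_sub_distrib, Finset.mul_sum]
  refine Finset.sum_le_sum fun j _ => ?_
  simpa [hur] using dotProduct_orthogonal_component_sq_le u r (M.col j) hu

/-- If `u` is a unit eigenvector of `M * Mᵀ` with eigenvalue `s`, every other direction carries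
at most the remaining mass `‖M‖_F² - s`. -/
theorem vecMul_dotProduct_self_le_of_eigenvector (M : Matrix m ι ℝ) (u a : m → ℝ) {s : ℝ}
    (hu : u ⬝ᵥ u = 1) (hs : (M * Mᵀ) *ᵥ u = s • u) :
    (a ᵥ* M) ⬝ᵥ (a ᵥ* M) ≤
      s * (u ⬝ᵥ a) ^ 2 + (∑ i, ∑ j, M i j ^ 2 - s) * (a ⬝ᵥ a - (u ⬝ᵥ a) ^ 2) := by
  have hpair (w : m → ℝ) : (w ᵥ* M) ⬝ᵥ (u ᵥ* M) = s * (w ⬝ᵥ u) := by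
    rw [← mulVec_transpose M u, ← dotProduct_mulVec, mulVec_mulVec, hs, dotProduct_smul,
      smul_eq_mul]
  have hur : u ⬝ᵥ (a - (u ⬝ᵥ a) • u) = 0 := by
    simp [dotProduct_sub, hu]
  have h := vecMul_dotProduct_self_le_of_orthogonal M u _ hu hur
  have hself := hpair u
  rw [hu, mul_one] at hself
  have hau := hpair a
  simp only [sub_vecMul, smul_vecMul, sub_dotProduct, dotProduct_sub, smul_dotProduct,
    dotProduct_smul, smul_eq_mul, hu, hself, hau, dotProduct_comm (u ᵥ* M) (a ᵥ* M),
    dotProduct_comm a u] at h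
  linarith

end SpectralNorm

/-- If `‖M‖_F = 1`, `a`, `b` are unit vectors, and `â` is a unit vector with
`M Mᵀ â = ‖M‖₂² â` (a top left singular vector of `M`), then
`min(‖â âᵀ − a aᵀ‖₂², 1/2) ≤ ‖vec(M)vec(M)ᵀ − vec(a bᵀ)vec(a bᵀ)ᵀ‖₂²`. -/
theorem stmt2 {d1 d2 : ℕ} (M : Matrix (Fin d1) (Fin d2) ℝ) (hM : frobNorm M = 1)
    (a : Fin d1 → ℝ) (b : Fin d2 → ℝ)
    (ha : ∑ i, (a i) ^ 2 = 1) (hb : ∑ j, (b j) ^ 2 = 1)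
    (ahat : Fin d1 → ℝ) (hahat : ∑ i, (ahat i) ^ 2 = 1)
    (htop : (M * Mᵀ) *ᵥ ahat = (sNorm M) ^ 2 • ahat) :
    min ((sNorm (Matrix.vecMulVec ahat ahat - Matrix.vecMulVec a a)) ^ 2) (1 / 2)
      ≤ (sNorm
          (Matrix.vecMulVec (fun p : Fin d1 × Fin d2 => M p.1 p.2)
              (fun p : Fin d1 × Fin d2 => M p.1 p.2)
            - Matrix.vecMulVec (fun p : Fin d1 × Fin d2 => a p.1 * b p.2)
                (fun p : Fin d1 × Fin d2 => a p.1 * b p.2))) ^ 2 := by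
  have ha' : a ⬝ᵥ a = 1 := by simpa [dotProduct, sq] using ha
  have hb' : b ⬝ᵥ b = 1 := by simpa [dotProduct, sq] using hb
  have hu' : ahat ⬝ᵥ ahat = 1 := by simpa [dotProduct, sq] using hahat
  have hF : ∑ i, ∑ j, M i j ^ 2 = 1 := Real.sqrt_eq_one.mp hM
  have hvecM : (fun p : Fin d1 × Fin d2 => M p.1 p.2) ⬝ᵥ (fun p => M p.1 p.2) = 1 := by
    simpa [dotProduct, Fintype.sum_prod_type, sq] using hF
  have hvecab : (fun p : Fin d1 × Fin d2 => a p.1 * b p.2) ⬝ᵥ (fun p => a p.1 * b p.2) = 1 := by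
    calc _ = (∑ i, a i ^ 2) * ∑ j, b j ^ 2 := by
          rw [Finset.sum_mul_sum, dotProduct, Fintype.sum_prod_type]
          exact Finset.sum_congr rfl fun i _ => Finset.sum_congr rfl fun j _ => by ring
      _ = 1 := by rw [ha, hb, one_mul]
  have hinner : (fun p : Fin d1 × Fin d2 => M p.1 p.2) ⬝ᵥ (fun p => a p.1 * b p.2) =
      a ⬝ᵥ (M *ᵥ b) := by
    simp only [dotProduct, mulVec, Fintype.sum_prod_type, Finset.mul_sum]
    exact Finset.sum_congr rfl fun i _ => Finset.sum_congr rfl fun j _ => by ring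
  rw [sNorm_vecMulVec_sub_sq _ _ hu' ha', sNorm_vecMulVec_sub_sq _ _ hvecM hvecab, hinner]
  have hcs : (a ⬝ᵥ (M *ᵥ b)) ^ 2 ≤ sNorm M ^ 2 := by
    have h₁ := dotProduct_sq_le a (M *ᵥ b)
    have h₂ := mulVec_dotProduct_self_le_sNorm_sq M b
    rw [ha', one_mul] at h₁
    rw [hb', mul_one] at h₂
    exact h₁.trans h₂
  have hca : (a ⬝ᵥ (M *ᵥ b)) ^ 2 ≤ (a ᵥ* M) ⬝ᵥ (a ᵥ* M) := by
    have h := dotProduct_sq_le (a ᵥ* M) b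
    rwa [hb', mul_one, ← dotProduct_mulVec] at h
  have hs1 : sNorm M ^ 2 ≤ 1 := by
    have h := vecMul_dotProduct_self_le M ahat
    rwa [← mulVec_transpose M ahat, dotProduct_mulVec, vecMul_transpose, mulVec_mulVec, htop,
      smul_dotProduct, smul_eq_mul, hu', hF, mul_one, mul_one] at h
  have hbound := hca.trans (vecMul_dotProduct_self_le_of_eigenvector M ahat a hu' htop)
  rw [hF, ha'] at hbound
  generalize (a ⬝ᵥ (M *ᵥ b)) ^ 2 = c at *
  generalize (ahat ⬝ᵥ a) ^ 2 = x at *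
  generalize sNorm M ^ 2 = s at *
  rcases le_or_gt c (1 / 2) with hc | hc
  · exact (min_le_right _ _).trans (by linarith)
  · refine (min_le_left _ _).trans ?_
    have hx : c ≤ x := by
      by_contra! hlt
      nlinarith [mul_pos (sub_pos.mpr hlt) (show 0 < 2 * s - 1 by linarith),
        mul_nonneg (show 0 ≤ 2 * c - 1 by linarith) (sub_nonneg.mpr hs1)]
    linarith
end

section
/- Let d, d', r be positive integers with r ≤ min(d, d') and let ε > 0. Then there exist matrices U_1, …, U_{N1} ∈ ℝ^{d×r} and V_1, …, V_{N2} ∈ ℝ^{d'×r} with N1 ≤ (1 + 4/ε)^{dr}, N2 ≤ (1 + 4/ε)^{d'r}, ‖U_j‖₂ ≤ 1 and ‖V_{j'}‖₂ ≤ 1, such that every M ∈ ℝ^{d×d'} with ‖M‖₂ ≤ 1 and rank(M) ≤ r satisfies min_{j, j'} ‖M − U_j V_{j'}ᵀ‖₂ ≤ ε. Consequently (taking ε = 1/4), there exist such matrices U_j (j ≤ 17^{dr}) and V_{j'} (j' ≤ 17^{d'r}) of spectral norm at most 1 such that for every real normed vector space V and every linear map f : ℝ^{d×d'} → V, sup_{‖M‖₂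 ≤ 1, rank(M) ≤ r} ‖f(M)‖_V ≤ 2 · max_{j, j'} ‖f(U_j V_{j'}ᵀ)‖_V. -/
open Matrix

universe u

section FiniteDimensional

open Module MeasureTheory Metric
open scoped ENNReal

variable {E : Type*} [NormedAddCommGroup E] [NormedSpace ℝ E] [FiniteDimensional ℝ E]

/-- Volumetric bound on the cardinality of a `δ`-separated subset of the unit ball. -/
theorem card_le_of_separated_unitBall {δ : ℝ} (hδ : 0 < δ) (s : Finset E)
    (hs : ∀ c ∈ s, ‖c‖ ≤ 1) (h : ∀ c ∈ s, ∀ d ∈ s, c ≠ d → δ ≤ ‖c - d‖) :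
    (s.card : ℝ) ≤ (1 + 2 / δ) ^ finrank ℝ E := by
  borelize E
  let μ : Measure E := Measure.addHaar
  have hη : 0 < δ / 2 := by positivity
  have hρ : 0 < 1 + δ / 2 := by positivity
  have hdisj : Set.Pairwise (s : Set E) (Function.onFun Disjoint fun c => ball c (δ / 2)) := by
    intro c hc d hd hcd
    apply ball_disjoint_ball
    rw [dist_eq_norm]
    linarith [h c hc d hd hcd]
  have hsub : (⋃ c ∈ s, ball c (δ / 2)) ⊆ ball (0 : E) (1 + δ / 2) := by
    refine Set.iUnion₂_subset fun x hx => ball_subset_ball' ?_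
    rw [dist_zero_right]
    linarith [hs x hx]
  have hvol : (s.card : ℝ≥0∞) * ENNReal.ofReal ((δ / 2) ^ finrank ℝ E) * μ (ball 0 1) ≤
      ENNReal.ofReal ((1 + δ / 2) ^ finrank ℝ E) * μ (ball 0 1) :=
    calc
      _ = μ (⋃ c ∈ s, ball c (δ / 2)) := by
        rw [measure_biUnion_finset hdisj fun c _ => measurableSet_ball]
        simp only [μ.addHaar_ball_of_pos _ hη, Finset.sum_const, nsmul_eq_mul, mul_assoc]
      _ ≤ μ (ball (0 : E) (1 + δ / 2)) := measure_mono hsub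
      _ = _ := by rw [μ.addHaar_ball_of_pos _ hρ]
  have hcard := ENNReal.toReal_le_of_le_ofReal (pow_nonneg hρ.le _)
    ((ENNReal.mul_le_mul_iff_left (measure_ball_pos _ _ zero_lt_one).ne'
      measure_ball_lt_top.ne).1 hvol)
  rw [ENNReal.toReal_mul, ENNReal.toReal_natCast, ENNReal.toReal_ofReal (by positivity),
    ← le_div_iff₀ (by positivity), ← div_pow] at hcard
  have hquot : (1 + δ / 2) / (δ / 2) = 1 + 2 / δ := by
    field_simp
    ring
  rwa [hquot] at hcard

/-- The unit ball of a finite-dimensional normed space has a `δ`-net of at most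
`(1 + 2 / δ) ^ dim` points. -/
theorem exists_net_unitBall {δ : ℝ} (hδ : 0 < δ) :
    ∃ (N : ℕ) (x : Fin N → E), (N : ℝ) ≤ (1 + 2 / δ) ^ finrank ℝ E ∧
      (∀ j, ‖x j‖ ≤ 1) ∧ ∀ y : E, ‖y‖ ≤ 1 → ∃ j, ‖y - x j‖ ≤ δ := by
  classical
  let S : Set ℕ := {n | ∃ s : Finset E, s.card = n ∧ (∀ c ∈ s, ‖c‖ ≤ 1) ∧
    ∀ c ∈ s, ∀ d ∈ s, c ≠ d → δ ≤ ‖c - d‖}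
  have hbdd : BddAbove S := by
    refine ⟨⌊(1 + 2 / δ) ^ finrank ℝ E⌋₊, ?_⟩
    rintro _ ⟨s, rfl, hs, hsep⟩
    exact Nat.le_floor (card_le_of_separated_unitBall hδ s hs hsep)
  obtain ⟨s, hcard, hs, hsep⟩ := Nat.sSup_mem (s := S) ⟨0, ∅, by simp⟩ hbdd
  refine ⟨s.card, fun j => (s.equivFin.symm j : E), card_le_of_separated_unitBall hδ s hs hsep,
    fun j => hs _ (s.equivFin.symm j).2, fun y hy => ?_⟩
  by_contra! hfar
  replace hfar : ∀ c ∈ s, δ < ‖y - c‖ := fun c hc => by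
    simpa using hfar (s.equivFin ⟨c, hc⟩)
  have hys : y ∉ s := fun hys => by
    have := hfar y hys
    simp at this
    linarith
  have hmem : s.card + 1 ∈ S := by
    refine ⟨insert y s, Finset.card_insert_of_notMem hys, ?_, ?_⟩
    · simpa using ⟨hy, hs⟩
    · intro c hc d hd hcd
      rcases Finset.mem_insert.1 hc with rfl | hc <;> rcases Finset.mem_insert.1 hd with rfl | hd
      · exact absurd rfl hcd
      · exact (hfar d hd).le
      · rw [norm_sub_rev]
        exact (hfar c ‹c ∈ s›).le
      · exact hsep c hc d hd hcd
  have := le_csSup hbdd hmem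
  omega

/-- A subspace can be enlarged to one of any prescribed larger dimension. -/
theorem Submodule.exists_ge_finrank_eq {K V : Type*} [Field K] [AddCommGroup V] [Module K V]
    [FiniteDimensional K V] (p : Submodule K V) {n : ℕ} (hp : finrank K p ≤ n)
    (hn : n ≤ finrank K V) : ∃ q : Submodule K V, p ≤ q ∧ finrank K q = n := by
  induction n, hp using Nat.le_induction with
  | base => exact ⟨p, le_rfl, rfl⟩
  | succ m _ ih =>
    obtain ⟨q, hpq, hq⟩ := ih (by omega)
    obtain ⟨v, hv⟩ := q.exists_of_finrank_lt (by omega)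
    have hvq : v ∉ q := by simpa using hv 1 one_ne_zero
    exact ⟨q ⊔ Submodule.span K {v}, hpq.trans le_sup_left, by
      rw [Submodule.finrank_sup_span_singleton hvq, hq]⟩

end FiniteDimensional

section SpectralNorm

open Module
open scoped Matrix.Norms.L2Operator

theorem sNorm_eq_norm {m n : Type*} [Fintype m] [Fintype n] [DecidableEq n]
    (M : Matrix m n ℝ) : sNorm M = ‖M‖ := rfl

theorem Matrix.l2_opNorm_transpose {m n : Type*} [Fintype m] [Fintype n] [DecidableEq m]
    [DecidableEq n] (M : Matrix m n ℝ) : ‖Mᵀ‖ = ‖M‖ := by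
  rw [← Matrix.conjTranspose_eq_transpose_of_trivial, Matrix.l2_opNorm_conjTranspose]

/-- A matrix of rank at most `r` factors through a matrix with `r` orthonormal columns. -/
theorem Matrix.exists_orthonormal_factor {d d' r : ℕ} (hrd : r ≤ d)
    (M : Matrix (Fin d) (Fin d') ℝ) (hM : M.rank ≤ r) :
    ∃ U : Matrix (Fin d) (Fin r) ℝ, Uᵀ * U = 1 ∧ U * (Uᵀ * M) = M := by
  let e := (WithLp.linearEquiv 2 ℝ (Fin d → ℝ)).symm
  let p : Submodule ℝ (EuclideanSpace ℝ (Fin d)) :=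
    (Submodule.span ℝ (Set.range M.col)).map (e : (Fin d → ℝ) →ₗ[ℝ] EuclideanSpace ℝ (Fin d))
  have hp : finrank ℝ p ≤ r := by
    rw [LinearEquiv.finrank_map_eq, ← Matrix.rank_eq_finrank_span_cols]
    exact hM
  obtain ⟨q, hpq, hq⟩ := Submodule.exists_ge_finrank_eq p hp (by simpa using hrd)
  let b : OrthonormalBasis (Fin r) ℝ q := (stdOrthonormalBasis ℝ q).reindex (finCongr hq)
  let U : Matrix (Fin d) (Fin r) ℝ := Matrix.of fun i j => (b j : EuclideanSpace ℝ (Fin d)) i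
  have hU : Uᵀ * U = 1 := by
    ext i j
    have h := orthonormal_iff_ite.1 b.orthonormal i j
    rw [Submodule.coe_inner, PiLp.inner_apply] at h
    simpa [Matrix.mul_apply, Matrix.one_apply, U, mul_comm] using h
  have hcol : ∀ c : Fin d', e (M.col c) ∈ q := fun c =>
    hpq (Submodule.mem_map_of_mem (Submodule.subset_span ⟨c, rfl⟩))
  let Z : Matrix (Fin r) (Fin d') ℝ := Matrix.of fun j c => b.repr ⟨_, hcol c⟩ j
  have hZ : U * Z = M := by
    ext i c
    have h := congrArg (fun x : q => (x : EuclideanSpace ℝ (Fin d)) i)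
      (b.sum_repr ⟨_, hcol c⟩)
    simpa [Matrix.mul_apply, U, Z, e, mul_comm] using h
  refine ⟨U, hU, ?_⟩
  rw [← hZ, ← Matrix.mul_assoc Uᵀ, hU, Matrix.one_mul]

/-- A contraction of rank at most `r` is a product of two contractions of inner dimension `r`. -/
theorem Matrix.exists_contraction_factorization {d d' r : ℕ} (hrd : r ≤ d)
    (M : Matrix (Fin d) (Fin d') ℝ) (hM : ‖M‖ ≤ 1) (hrank : M.rank ≤ r) :
    ∃ (U : Matrix (Fin d) (Fin r) ℝ) (V : Matrix (Fin d') (Fin r) ℝ),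
      ‖U‖ ≤ 1 ∧ ‖V‖ ≤ 1 ∧ M = U * Vᵀ := by
  obtain ⟨U, hU, hUM⟩ := M.exists_orthonormal_factor hrd hrank
  have hone : ‖(1 : Matrix (Fin r) (Fin r) ℝ)‖ ≤ 1 := by
    rw [← Matrix.diagonal_one, Matrix.l2_opNorm_diagonal]
    exact (pi_norm_le_iff_of_nonneg zero_le_one).2 fun i => by simp
  have hUnorm : ‖U‖ ≤ 1 := by
    have h := Matrix.l2_opNorm_conjTranspose_mul_self U
    rw [Matrix.conjTranspose_eq_transpose_of_trivial, hU] at h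
    nlinarith [norm_nonneg U]
  refine ⟨U, (Uᵀ * M)ᵀ, hUnorm, ?_, by rw [Matrix.transpose_transpose, hUM]⟩
  rw [Matrix.l2_opNorm_transpose]
  refine (Matrix.l2_opNorm_mul _ _).trans (mul_le_one₀ ?_ (norm_nonneg _) hM)
  rwa [Matrix.l2_opNorm_transpose]

theorem Matrix.exists_net_contractions (m n : ℕ) {ε : ℝ} (hε : 0 < ε) :
    ∃ (N : ℕ) (x : Fin N → Matrix (Fin m) (Fin n) ℝ), (N : ℝ) ≤ (1 + 4 / ε) ^ (m * n) ∧
      (∀ j, ‖x j‖ ≤ 1) ∧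
      ∀ y : Matrix (Fin m) (Fin n) ℝ, ‖y‖ ≤ 1 → ∃ j, ‖y - x j‖ ≤ ε / 2 := by
  obtain ⟨N, x, hN, hx, hnet⟩ :=
    exists_net_unitBall (E := Matrix (Fin m) (Fin n) ℝ) (half_pos hε)
  refine ⟨N, x, hN.trans_eq ?_, hx, hnet⟩
  rw [Module.finrank_matrix, Module.finrank_self]
  simp only [Fintype.card_fin, mul_one]
  congr 2
  field_simp
  norm_num

theorem Matrix.mul_transpose_sub_mul_transpose {m n k : Type*} [Fintype k]
    (U U' : Matrix m k ℝ) (V V' : Matrix n k ℝ) :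
    U * Vᵀ - U' * V'ᵀ = (U - U') * Vᵀ + U' * (V - V')ᵀ := by
  rw [Matrix.transpose_sub, Matrix.sub_mul, Matrix.mul_sub]
  abel

theorem Matrix.l2_opNorm_mul_transpose_le {d d' r : ℕ} (A : Matrix (Fin d) (Fin r) ℝ)
    (B : Matrix (Fin d') (Fin r) ℝ) : ‖A * Bᵀ‖ ≤ ‖A‖ * ‖B‖ := by
  simpa only [Matrix.l2_opNorm_transpose] using Matrix.l2_opNorm_mul A Bᵀ

theorem Matrix.l2_opNorm_mul_transpose_sub_le {d d' r : ℕ} (U U' : Matrix (Fin d) (Fin r) ℝ)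
    (V V' : Matrix (Fin d') (Fin r) ℝ) :
    ‖U * Vᵀ - U' * V'ᵀ‖ ≤ ‖U - U'‖ * ‖V‖ + ‖U'‖ * ‖V - V'‖ := by
  rw [Matrix.mul_transpose_sub_mul_transpose]
  exact (norm_add_le _ _).trans (add_le_add (Matrix.l2_opNorm_mul_transpose_le _ _)
    (Matrix.l2_opNorm_mul_transpose_le _ _))

/-- Bilinear bootstrapping: a linear map on products `U * Vᵀ` of contractions is controlled by its
values on products of elements of `1 / 8`-nets. -/
theorem Matrix.exists_norm_map_mul_transpose_le {d d' r : ℕ} {ι κ W : Type*} [Finite ι] [Finite κ]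
    [NormedAddCommGroup W] [NormedSpace ℝ W] (f : Matrix (Fin d) (Fin d') ℝ →ₗ[ℝ] W)
    (U : ι → Matrix (Fin d) (Fin r) ℝ) (V : κ → Matrix (Fin d') (Fin r) ℝ)
    (hU : ∀ j, ‖U j‖ ≤ 1)
    (hUnet : ∀ A : Matrix (Fin d) (Fin r) ℝ, ‖A‖ ≤ 1 → ∃ j, ‖A - U j‖ ≤ 1 / 8)
    (hVnet : ∀ B : Matrix (Fin d') (Fin r) ℝ, ‖B‖ ≤ 1 → ∃ j, ‖B - V j‖ ≤ 1 / 8) :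
    ∃ j j', ∀ (A : Matrix (Fin d) (Fin r) ℝ) (B : Matrix (Fin d') (Fin r) ℝ),
      ‖A‖ ≤ 1 → ‖B‖ ≤ 1 → ‖f (A * Bᵀ)‖ ≤ 2 * ‖f (U j * (V j')ᵀ)‖ := by
  have : Nonempty ι := ⟨(hUnet 0 (by simp)).choose⟩
  have : Nonempty κ := ⟨(hVnet 0 (by simp)).choose⟩
  obtain ⟨⟨j, j'⟩, hmax⟩ := Finite.exists_max fun p : ι × κ => ‖f (U p.1 * (V p.2)ᵀ)‖
  refine ⟨j, j', fun A₀ B₀ hA₀ hB₀ => ?_⟩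
  let S : Set ℝ := {t | ∃ (A : Matrix (Fin d) (Fin r) ℝ) (B : Matrix (Fin d') (Fin r) ℝ),
    ‖A‖ ≤ 1 ∧ ‖B‖ ≤ 1 ∧ ‖f (A * Bᵀ)‖ = t}
  have hbdd : BddAbove S := by
    refine ⟨‖f.toContinuousLinearMap‖, ?_⟩
    rintro _ ⟨A, B, hA, hB, rfl⟩
    refine f.toContinuousLinearMap.unit_le_opNorm _ ?_
    exact (Matrix.l2_opNorm_mul_transpose_le A B).trans (mul_le_one₀ hA (norm_nonneg _) hB)
  have hscale : ∀ (A : Matrix (Fin d) (Fin r) ℝ) (B : Matrix (Fin d') (Fin r) ℝ) (a b : ℝ),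
      0 < a → 0 < b → ‖A‖ ≤ a → ‖B‖ ≤ b → ‖f (A * Bᵀ)‖ ≤ a * b * sSup S := by
    intro A B a b ha hb hA hB
    have h : ‖f ((a⁻¹ • A) * (b⁻¹ • B)ᵀ)‖ ≤ sSup S := by
      refine le_csSup hbdd ⟨_, _, ?_, ?_, rfl⟩
      · rw [norm_smul, Real.norm_of_nonneg (by positivity), inv_mul_le_iff₀ ha]
        linarith
      · rw [norm_smul, Real.norm_of_nonneg (by positivity), inv_mul_le_iff₀ hb]
        linarith
    rw [Matrix.transpose_smul, Matrix.smul_mul, Matrix.mul_smul, map_smul, map_smul, norm_smul,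
      norm_smul, Real.norm_of_nonneg (by positivity), Real.norm_of_nonneg (by positivity),
      inv_mul_le_iff₀ ha, inv_mul_le_iff₀ hb] at h
    linarith
  have hsup : sSup S ≤ ‖f (U j * (V j')ᵀ)‖ + sSup S / 4 := by
    refine csSup_le ⟨_, A₀, B₀, hA₀, hB₀, rfl⟩ ?_
    rintro _ ⟨A, B, hA, hB, rfl⟩
    obtain ⟨i, hi⟩ := hUnet A hA
    obtain ⟨i', hi'⟩ := hVnet B hB
    have hsplit : f (A * Bᵀ) =
        f (U i * (V i')ᵀ) + (f ((A - U i) * Bᵀ) + f (U i * (B - V i')ᵀ)) := by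
      rw [← map_add, ← map_add, ← Matrix.mul_transpose_sub_mul_transpose, add_sub_cancel]
    have h₁ := hscale (A - U i) B (1 / 8) 1 (by norm_num) one_pos hi hB
    have h₂ := hscale (U i) (B - V i') 1 (1 / 8) one_pos (by norm_num) (hU i) hi'
    have h₃ := hmax (i, i')
    rw [hsplit]
    refine (norm_add_le _ _).trans ?_
    linarith [norm_add_le (f ((A - U i) * Bᵀ)) (f (U i * (B - V i')ᵀ))]
  have hle : ‖f (A₀ * B₀ᵀ)‖ ≤ sSup S := le_csSup hbdd ⟨A₀, B₀, hA₀, hB₀, rfl⟩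
  linarith [norm_nonneg (f (U j * (V j')ᵀ))]

end SpectralNorm

/-- ε-net, in the spectral norm, for matrices `M ∈ ℝ^{d×d'}` with `‖M‖₂ ≤ 1` and
`rank(M) ≤ r`, of the form `U_j V_{j'}ᵀ` with net sizes `(1+4/ε)^{dr}`, `(1+4/ε)^{d'r}`;
consequently (with `ε = 1/4`, net sizes `17^{dr}`, `17^{d'r}`), for every linear map `f` into a
real normed space, the sup of `‖f‖` over the low-rank unit ball is at most twice the max over
the net. -/
theorem stmt4 {d d' r : ℕ} (hd : 0 < d) (hd' : 0 < d') (hr : 0 < r)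
    (hrmin : r ≤ min d d') (ε : ℝ) (hε : 0 < ε) :
    (∃ (N1 N2 : ℕ) (U : Fin N1 → Matrix (Fin d) (Fin r) ℝ)
        (V : Fin N2 → Matrix (Fin d') (Fin r) ℝ),
        (N1 : ℝ) ≤ (1 + 4 / ε) ^ (d * r) ∧ (N2 : ℝ) ≤ (1 + 4 / ε) ^ (d' * r) ∧
        (∀ j, sNorm (U j) ≤ 1) ∧ (∀ j', sNorm (V j') ≤ 1) ∧
        ∀ M : Matrix (Fin d) (Fin d') ℝ, sNorm M ≤ 1 → M.rank ≤ r →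
          ∃ j j', sNorm (M - U j * (V j')ᵀ) ≤ ε) ∧
    (∃ (N1 N2 : ℕ) (U : Fin N1 → Matrix (Fin d) (Fin r) ℝ)
        (V : Fin N2 → Matrix (Fin d') (Fin r) ℝ),
        (N1 : ℝ) ≤ 17 ^ (d * r) ∧ (N2 : ℝ) ≤ 17 ^ (d' * r) ∧
        (∀ j, sNorm (U j) ≤ 1) ∧ (∀ j', sNorm (V j') ≤ 1) ∧
        ∀ (W : Type u) [NormedAddCommGroup W] [NormedSpace ℝ W]
          (f : Matrix (Fin d) (Fin d') ℝ →ₗ[ℝ] W)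
          (M : Matrix (Fin d) (Fin d') ℝ), sNorm M ≤ 1 → M.rank ≤ r →
          ∃ j j', ‖f M‖ ≤ 2 * ‖f (U j * (V j')ᵀ)‖) := by
  simp only [sNorm_eq_norm]
  have hrd : r ≤ d := hrmin.trans (min_le_left _ _)
  constructor
  · obtain ⟨N1, U, hN1, hU, hUnet⟩ := Matrix.exists_net_contractions d r hε
    obtain ⟨N2, V, hN2, hV, hVnet⟩ := Matrix.exists_net_contractions d' r hε
    refine ⟨N1, N2, U, V, hN1, hN2, hU, hV, fun M hM hrank => ?_⟩
    obtain ⟨A, B, hA, hB, rfl⟩ := M.exists_contraction_factorization hrd hM hrank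
    obtain ⟨j, hj⟩ := hUnet A hA
    obtain ⟨j', hj'⟩ := hVnet B hB
    refine ⟨j, j', (Matrix.l2_opNorm_mul_transpose_sub_le A (U j) B (V j')).trans ?_⟩
    have h₁ := mul_le_of_le_one_right (half_pos hε).le hB
    have h₂ := mul_le_of_le_one_left (half_pos hε).le (hU j)
    refine (add_le_add (mul_le_mul_of_nonneg_right hj ?_) (mul_le_mul_of_nonneg_left hj' ?_)).trans
      (by linarith)
    · exact norm_nonneg (LinearMap.toContinuousLinearMap (Matrix.toEuclideanLin B))
    · exact norm_nonneg (LinearMap.toContinuousLinearMap (Matrix.toEuclideanLin (U j)))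
  · obtain ⟨N1, U, hN1, hU, hUnet⟩ :=
      Matrix.exists_net_contractions d r (ε := 1 / 4) (by norm_num)
    obtain ⟨N2, V, hN2, hV, hVnet⟩ :=
      Matrix.exists_net_contractions d' r (ε := 1 / 4) (by norm_num)
    norm_num at hN1 hN2
    refine ⟨N1, N2, U, V, hN1, hN2, hU, hV, fun W _ _ f M hM hrank => ?_⟩
    obtain ⟨A, B, hA, hB, rfl⟩ := M.exists_contraction_factorization hrd hM hrank
    obtain ⟨j, j', h⟩ := Matrix.exists_norm_map_mul_transpose_le f U V hU
      (fun A hA => (hUnet A hA).imp fun _ h => h.trans (by norm_num))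
      (fun B hB => (hVnet B hB).imp fun _ h => h.trans (by norm_num))
    exact ⟨j, j', h A B hA hB⟩
end

section
/- Let K be a positive integer, and for each k ∈ {1, …, K} let d_k, d_k', r_k be positive integers with r_k ≤ min(d_k, d_k'); let ε > 0. Then for each k there exist matrices U_{j,k} ∈ ℝ^{d_k×r_k} (1 ≤ j ≤ N_k with N_k ≤ (1 + 4/ε)^{d_k r_k}) and V_{j',k} ∈ ℝ^{d_k'×r_k} (1 ≤ j' ≤ N_k' with N_k' ≤ (1 + 4/ε)^{d_k' r_k}), all of spectral norm at most 1, such that for all matrices M_1, …, M_K with M_k ∈ ℝ^{d_k×d_k'}, ‖M_k‖₂ ≤ 1 and rank(M_k) ≤ r_k, one has min over index tuples (j_1, j_1', …, j_K, j_K') of ‖ ⊗_{k=1}^K M_k − ⊗_{k=1}^K (U_{j_k,k} V_{j_k',k}ᵀ) ‖₂ ≤ ε·K. Consequently (taking ε = 1/(8K)), such nets can be chosen so that for every real normed vector space V and every linear map f from the space of (∏_k d_k)×(∏_k d_k') real matrices to V, sup over admissible (M_1, …, M_K) of ‖f(⊗_{k=1}^K M_k)‖_V ≤ 2 · max over net tuples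 of ‖f(⊗_{k=1}^K U_{j_k,k} V_{j_k',k}ᵀ)‖_V. -/
open Matrix

universe u

/-- Iterated Kronecker product of a family of matrices `M k ∈ ℝ^{d_k × d'_k}`, realized as the
matrix on the product index sets `(∏_k d_k) × (∏_k d'_k)` with entries
`(⊗_k M_k)_{i,j} = ∏_k (M_k)_{i_k, j_k}`. -/
def kron {K : ℕ} {d d' : Fin K → ℕ} (M : ∀ k, Matrix (Fin (d k)) (Fin (d' k)) ℝ) :
    Matrix (∀ k, Fin (d k)) (∀ k, Fin (d' k)) ℝ :=
  fun i j => ∏ k, M k (i k) (j k)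

open scoped Matrix.Norms.L2Operator

/-- The spectral norm bounds the Euclidean norm of `A x`, written with sums of squares. -/
lemma sum_sq_le_norm {m n : Type*} [Fintype m] [Fintype n] [DecidableEq n]
    (A : Matrix m n ℝ) (x : n → ℝ) :
    ∑ i, (∑ j, A i j * x j) ^ 2 ≤ ‖A‖ ^ 2 * ∑ j, x j ^ 2 := by
  have h := A.l2_opNorm_mulVec (WithLp.toLp 2 x)
  have h2 := pow_le_pow_left₀ (norm_nonneg _) h 2
  rw [mul_pow, EuclideanSpace.norm_sq_eq, EuclideanSpace.norm_sq_eq] at h2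
  simpa [Matrix.mulVec, dotProduct] using h2

lemma norm_le_of_sum_sq_le {m n : Type*} [Fintype m] [Fintype n] [DecidableEq n]
    (A : Matrix m n ℝ) {c : ℝ} (hc : 0 ≤ c)
    (h : ∀ x : n → ℝ, ∑ i, (∑ j, A i j * x j) ^ 2 ≤ c ^ 2 * ∑ j, x j ^ 2) : ‖A‖ ≤ c := by
  rw [Matrix.l2_opNorm_def]
  refine ContinuousLinearMap.opNorm_le_bound _ hc fun x => ?_
  refine (sq_le_sq₀ (norm_nonneg _) (by positivity)).1 ?_
  rw [mul_pow, EuclideanSpace.norm_sq_eq, EuclideanSpace.norm_sq_eq]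
  simpa [Matrix.mulVec, dotProduct] using h x.ofLp

/-- The spectral norm is submultiplicative under iterated Kronecker products. -/
lemma norm_kron_le : ∀ {K : ℕ} {d d' : Fin K → ℕ}
    (M : ∀ k, Matrix (Fin (d k)) (Fin (d' k)) ℝ), ‖kron M‖ ≤ ∏ k, ‖M k‖
  | 0, d, d', M => by
    refine norm_le_of_sum_sq_le _ (Finset.prod_nonneg fun _ _ => norm_nonneg _) fun x => ?_
    simp [kron]
  | K + 1, d, d', M => by
    refine norm_le_of_sum_sq_le _ (Finset.prod_nonneg fun _ _ => norm_nonneg _) fun x => ?_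
    rw [Fin.prod_univ_succ]
    have ih := norm_kron_le fun k : Fin K => M k.succ
    set B := kron fun k : Fin K => M k.succ with hB
    set b := ∏ k : Fin K, ‖M k.succ‖ with hb
    rw [← (Fin.consEquiv fun k => Fin (d k)).sum_comp,
      ← (Fin.consEquiv fun k => Fin (d' k)).sum_comp]
    simp_rw [← (Fin.consEquiv fun k => Fin (d' k)).sum_comp, Fintype.sum_prod_type]
    have hk : ∀ i p j q, kron M (Fin.consEquiv (fun k => Fin (d k)) (i, p))
        (Fin.consEquiv (fun k => Fin (d' k)) (j, q)) = M 0 i j * B p q := by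
      intro i p j q
      simp [kron, hB, Fin.prod_univ_succ, Fin.consEquiv]
    simp_rw [hk]
    set y : Fin (d' 0) → (∀ k : Fin K, Fin (d' k.succ)) → ℝ :=
      fun j q => x (Fin.consEquiv (fun k => Fin (d' k)) (j, q)) with hy
    calc ∑ i, ∑ p, (∑ j, ∑ q, M 0 i j * B p q * y j q) ^ 2
        = ∑ p, ∑ i, (∑ j, M 0 i j * ∑ q, B p q * y j q) ^ 2 := by
          rw [Finset.sum_comm]
          simp_rw [Finset.mul_sum, mul_assoc]
      _ ≤ ∑ p, ‖M 0‖ ^ 2 * ∑ j, (∑ q, B p q * y j q) ^ 2 :=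
          Finset.sum_le_sum fun p _ => sum_sq_le_norm _ _
      _ = ‖M 0‖ ^ 2 * ∑ j, ∑ p, (∑ q, B p q * y j q) ^ 2 := by
          rw [← Finset.mul_sum, Finset.sum_comm]
      _ ≤ ‖M 0‖ ^ 2 * ∑ j, b ^ 2 * ∑ q, y j q ^ 2 := by
          gcongr with j
          exact (sum_sq_le_norm _ _).trans (by gcongr)
      _ = (‖M 0‖ * b) ^ 2 * ∑ j, ∑ q, y j q ^ 2 := by
          rw [← Finset.mul_sum]; ring

/-- Volumetric bound on the size of a `δ`-net of the unit ball contained in the ball. -/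
lemma exists_finset_net_closedBall (E : Type*) [NormedAddCommGroup E] [NormedSpace ℝ E]
    [FiniteDimensional ℝ E] {δ : ℝ} (hδ : 0 < δ) :
    ∃ s : Finset E, (s.card : ℝ) ≤ (1 + 2 / δ) ^ Module.finrank ℝ E ∧ (∀ c ∈ s, ‖c‖ ≤ 1) ∧
      ∀ x : E, ‖x‖ ≤ 1 → ∃ c ∈ s, ‖x - c‖ ≤ δ := by
  classical
  have key : ∀ s : Finset E, (∀ c ∈ s, ‖c‖ ≤ 1) →
      (s : Set E).Pairwise (fun c d => δ < ‖c - d‖) →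
      (s.card : ℝ) ≤ (1 + 2 / δ) ^ Module.finrank ℝ E := by
    intro s hs hsep
    borelize E
    let μ : MeasureTheory.Measure E := MeasureTheory.Measure.addHaar
    have hdisj : (s : Set E).PairwiseDisjoint fun c => Metric.ball c (δ / 2) := by
      intro c hc d hd hcd
      apply Metric.ball_disjoint_ball
      rw [dist_eq_norm]
      linarith [hsep hc hd hcd]
    have hsub : (⋃ c ∈ s, Metric.ball c (δ / 2)) ⊆ Metric.ball (0 : E) (1 + δ / 2) := by
      refine Set.iUnion₂_subset fun c hc => Metric.ball_subset_ball' ?_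
      rw [dist_zero_right]
      linarith [hs c hc]
    have hμ := MeasureTheory.measure_mono (μ := μ) hsub
    rw [MeasureTheory.measure_biUnion_finset hdisj fun c _ => measurableSet_ball] at hμ
    simp only [μ.addHaar_ball_of_pos _ (half_pos hδ),
      μ.addHaar_ball_of_pos _ (show 0 < 1 + δ / 2 by positivity), Finset.sum_const, nsmul_eq_mul,
      ← mul_assoc] at hμ
    have hle := (ENNReal.mul_le_mul_iff_left (Metric.measure_ball_pos _ _ zero_lt_one).ne'
      MeasureTheory.measure_ball_lt_top.ne).1 hμ
    have hreal := ENNReal.toReal_le_of_le_ofReal (by positivity) hle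
    rw [ENNReal.toReal_mul, ENNReal.toReal_natCast, ENNReal.toReal_ofReal (by positivity)] at hreal
    have hrw : 1 + 2 / δ = (1 + δ / 2) / (δ / 2) := by
      field_simp
      ring
    rw [hrw, div_pow, le_div_iff₀ (by positivity)]
    exact hreal
  obtain ⟨B, hB⟩ := exists_nat_ge ((1 + 2 / δ) ^ Module.finrank ℝ E)
  let P : ℕ → Prop := fun n => ∃ s : Finset E, (∀ c ∈ s, ‖c‖ ≤ 1) ∧
    (s : Set E).Pairwise (fun c d => δ < ‖c - d‖) ∧ s.card = n
  obtain ⟨s, hs, hsep, hcard⟩ : P (Nat.findGreatest P B) :=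
    Nat.findGreatest_spec (m := 0) (Nat.zero_le _) ⟨∅, by simp, by simp, rfl⟩
  refine ⟨s, key s hs hsep, hs, fun x hx => ?_⟩
  by_contra! hfar
  have hxs : x ∉ s := fun h => absurd (hδ.trans (hfar x h)) (by simp)
  have hs' : ∀ c ∈ insert x s, ‖c‖ ≤ 1 := by
    simpa [hx] using hs
  have hsep' : ((insert x s : Finset E) : Set E).Pairwise (fun c d => δ < ‖c - d‖) := by
    rw [Finset.coe_insert]
    refine hsep.insert fun c hc _ => ⟨hfar c hc, ?_⟩
    rw [norm_sub_rev]
    exact hfar c hc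
  have hle : (insert x s).card ≤ B := by
    exact_mod_cast (key _ hs' hsep').trans hB
  have := Nat.le_findGreatest (P := P) hle ⟨_, hs', hsep', rfl⟩
  rw [Finset.card_insert_of_notMem hxs] at this
  omega

lemma exists_net_unitBall_matrix (m n : ℕ) {ε : ℝ} (hε : 0 < ε) :
    ∃ (N : ℕ) (U : Fin N → Matrix (Fin m) (Fin n) ℝ),
      (N : ℝ) ≤ (1 + 4 / ε) ^ (m * n) ∧ (∀ j, ‖U j‖ ≤ 1) ∧
      ∀ A : Matrix (Fin m) (Fin n) ℝ, ‖A‖ ≤ 1 → ∃ j, ‖A - U j‖ ≤ ε / 2 := by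
  obtain ⟨s, hcard, hs, hcov⟩ :=
    exists_finset_net_closedBall (Matrix (Fin m) (Fin n) ℝ) (half_pos hε)
  refine ⟨s.card, fun j => s.equivFin.symm j, ?_, fun j => hs _ (s.equivFin.symm j).2, ?_⟩
  · rw [Module.finrank_matrix, Module.finrank_self, Fintype.card_fin, Fintype.card_fin,
      mul_one] at hcard
    convert hcard using 3
    field_simp
    norm_num
  · intro A hA
    obtain ⟨c, hc, h⟩ := hcov A hA
    exact ⟨s.equivFin ⟨c, hc⟩, by simpa using h⟩

lemma norm_transpose_eq {m n : Type*} [Fintype m] [Fintype n] [DecidableEq m] [DecidableEq n]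
    (A : Matrix m n ℝ) : ‖Aᵀ‖ = ‖A‖ := by
  rw [← Matrix.conjTranspose_eq_transpose_of_trivial, Matrix.l2_opNorm_conjTranspose]

lemma exists_linearIsometry_euclideanSpace (E : Type*) [NormedAddCommGroup E]
    [InnerProductSpace ℝ E] [FiniteDimensional ℝ E] {r : ℕ} (h : Module.finrank ℝ E ≤ r) :
    Nonempty (E →ₗᵢ[ℝ] EuclideanSpace ℝ (Fin r)) := by
  let b := stdOrthonormalBasis ℝ E
  let v : Fin (Module.finrank ℝ E) → EuclideanSpace ℝ (Fin r) :=
    fun i => EuclideanSpace.basisFun (Fin r) ℝ (Fin.castLE h i)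
  have hv : Orthonormal ℝ v :=
    (EuclideanSpace.basisFun (Fin r) ℝ).orthonormal.comp _ (Fin.castLE_injective h)
  refine ⟨(b.toBasis.constr ℝ v).isometryOfOrthonormal (v := b.toBasis)
    (by simp) ?_⟩
  convert hv
  ext1 i
  simp

/-- A contraction of rank at most `r` factors as `U * Vᵀ` with contractions `U`, `V` having `r`
columns. -/
lemma exists_mul_transpose_of_rank_le {m n r : ℕ} (M : Matrix (Fin m) (Fin n) ℝ)
    (hM : ‖M‖ ≤ 1) (hr : M.rank ≤ r) :
    ∃ (U : Matrix (Fin m) (Fin r) ℝ) (V : Matrix (Fin n) (Fin r) ℝ),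
      ‖U‖ ≤ 1 ∧ ‖V‖ ≤ 1 ∧ M = U * Vᵀ := by
  let T := Matrix.toEuclideanLin M
  let C := LinearMap.range T
  have hC : Module.finrank ℝ C ≤ r := by
    exact (M.rank_eq_finrank_range_toLin (PiLp.basisFun 2 ℝ _)
      (PiLp.basisFun 2 ℝ _)).symm.trans_le hr
  obtain ⟨L⟩ := exists_linearIsometry_euclideanSpace C hC
  let u : EuclideanSpace ℝ (Fin r) →L[ℝ] EuclideanSpace ℝ (Fin m) :=
    C.subtypeL ∘L ContinuousLinearMap.adjoint L.toContinuousLinearMap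
  let w : EuclideanSpace ℝ (Fin n) →ₗ[ℝ] EuclideanSpace ℝ (Fin r) :=
    L.toLinearMap ∘ₗ T.rangeRestrict
  have hLx : ∀ x : C, ContinuousLinearMap.adjoint L.toContinuousLinearMap (L x) = x := by
    intro x
    refine ext_inner_right ℝ fun y => ?_
    rw [ContinuousLinearMap.adjoint_inner_left]
    exact L.inner_map_map x y
  have hu : ‖u‖ ≤ 1 := by
    refine (ContinuousLinearMap.opNorm_comp_le _ _).trans ?_
    rw [LinearIsometryEquiv.norm_map]
    exact mul_le_one₀ C.norm_subtypeL_le (by positivity) L.norm_toContinuousLinearMap_le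
  have hw : ‖LinearMap.toContinuousLinearMap w‖ ≤ 1 := by
    refine ContinuousLinearMap.opNorm_le_bound _ zero_le_one fun x => ?_
    have hx : ‖T x‖ ≤ ‖M‖ * ‖x‖ := (LinearMap.toContinuousLinearMap T).le_opNorm x
    calc ‖w x‖ = ‖T x‖ := L.norm_map _
      _ ≤ ‖M‖ * ‖x‖ := hx
      _ ≤ 1 * ‖x‖ := by gcongr
  have huw : u.toLinearMap ∘ₗ w = T := by
    ext1 x
    exact congrArg Subtype.val (hLx (T.rangeRestrict x))
  refine ⟨Matrix.toEuclideanLin.symm u.toLinearMap, (Matrix.toEuclideanLin.symm w)ᵀ, ?_, ?_, ?_⟩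
  · rw [Matrix.l2_opNorm_def]
    simp only [LinearEquiv.trans_apply, LinearEquiv.apply_symm_apply]
    exact hu
  · rw [norm_transpose_eq, Matrix.l2_opNorm_def]
    simpa using hw
  · apply Matrix.toEuclideanLin.injective
    rw [Matrix.transpose_transpose]
    rw [Matrix.toLpLin_mul (q := 2), LinearEquiv.apply_symm_apply, LinearEquiv.apply_symm_apply]
    exact huw.symm

section Telescoping

variable {K : ℕ} {d d' : Fin K → ℕ}

lemma kron_update_apply (C : ∀ k, Matrix (Fin (d k)) (Fin (d' k)) ℝ) (k : Fin K)
    (X : Matrix (Fin (d k)) (Fin (d' k)) ℝ) (a : ∀ k, Fin (d k)) (b : ∀ k, Fin (d' k)) :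
    kron (Function.update C k X) a b =
      X (a k) (b k) * ∏ i ∈ Finset.univ.erase k, C i (a i) (b i) := by
  rw [kron, ← Finset.mul_prod_erase _ _ (Finset.mem_univ k), Function.update_self]
  congr 1
  refine Finset.prod_congr rfl fun i hi => ?_
  rw [Function.update_of_ne (Finset.ne_of_mem_erase hi)]

lemma kron_update_add (C : ∀ k, Matrix (Fin (d k)) (Fin (d' k)) ℝ) (k : Fin K)
    (X Y : Matrix (Fin (d k)) (Fin (d' k)) ℝ) :
    kron (Function.update C k (X + Y)) =
      kron (Function.update C k X) + kron (Function.update C k Y) := by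
  ext a b
  simp only [kron_update_apply, Matrix.add_apply]
  ring

lemma kron_update_sub (C : ∀ k, Matrix (Fin (d k)) (Fin (d' k)) ℝ) (k : Fin K)
    (X Y : Matrix (Fin (d k)) (Fin (d' k)) ℝ) :
    kron (Function.update C k (X - Y)) =
      kron (Function.update C k X) - kron (Function.update C k Y) := by
  ext a b
  simp only [kron_update_apply, Matrix.sub_apply]
  ring

lemma kron_update_smul (C : ∀ k, Matrix (Fin (d k)) (Fin (d' k)) ℝ) (k : Fin K) (c : ℝ)
    (X : Matrix (Fin (d k)) (Fin (d' k)) ℝ) :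
    kron (Function.update C k (c • X)) = c • kron (Function.update C k X) := by
  ext a b
  simp only [kron_update_apply, Matrix.smul_apply, smul_eq_mul]
  ring

/-- Telescoping estimate for the difference of two Kronecker products. -/
lemma seminorm_kron_sub_kron_le
    (p : Seminorm ℝ (Matrix (∀ k, Fin (d k)) (∀ k, Fin (d' k)) ℝ))
    (A B : ∀ k, Matrix (Fin (d k)) (Fin (d' k)) ℝ) {η : ℝ}
    (h : ∀ (C : ∀ k, Matrix (Fin (d k)) (Fin (d' k)) ℝ), (∀ i, C i = A i ∨ C i = B i) →
      ∀ k, p (kron (Function.update C k (A k - B k))) ≤ η) :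
    p (kron A - kron B) ≤ K * η := by
  suffices H : ∀ s : Finset (Fin K), p (kron (s.piecewise A B) - kron B) ≤ s.card * η by
    simpa using H Finset.univ
  intro s
  induction s using Finset.induction_on with
  | empty => simp
  | insert k s hk ih =>
    have hC : ∀ i, s.piecewise A B i = A i ∨ s.piecewise A B i = B i := fun i => by
      by_cases hi : i ∈ s <;> simp [hi]
    have hself : Function.update (s.piecewise A B) k (B k) = s.piecewise A B := by
      rw [← Finset.piecewise_eq_of_notMem s A B hk, Function.update_eq_self]
    have hsplit : kron ((insert k s).piecewise A B) - kron B =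
        kron (Function.update (s.piecewise A B) k (A k - B k)) +
          (kron (s.piecewise A B) - kron B) := by
      rw [Finset.piecewise_insert, kron_update_sub, hself]
      abel
    rw [hsplit, Finset.card_insert_of_notMem hk]
    push_cast
    linarith [map_add_le_add p (kron (Function.update (s.piecewise A B) k (A k - B k)))
      (kron (s.piecewise A B) - kron B), h _ hC k]

end Telescoping

lemma rank_mul_transpose_le {m n r : ℕ} (U : Matrix (Fin m) (Fin r) ℝ)
    (V : Matrix (Fin n) (Fin r) ℝ) : (U * Vᵀ).rank ≤ r :=
  (Matrix.rank_mul_le_left _ _).trans (by simpa using U.rank_le_card_width)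

lemma norm_mul_transpose_le_one {m n r : ℕ} {U : Matrix (Fin m) (Fin r) ℝ}
    {V : Matrix (Fin n) (Fin r) ℝ} (hU : ‖U‖ ≤ 1) (hV : ‖V‖ ≤ 1) : ‖U * Vᵀ‖ ≤ 1 := by
  refine (Matrix.l2_opNorm_mul _ _).trans ?_
  rw [norm_transpose_eq]
  exact mul_le_one₀ hU (norm_nonneg _) hV

lemma norm_inv_smul_le_one {E : Type*} [NormedAddCommGroup E] [NormedSpace ℝ E] {x : E} {δ : ℝ}
    (hδ : 0 < δ) (hx : ‖x‖ ≤ δ) : ‖δ⁻¹ • x‖ ≤ 1 := by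
  rw [norm_smul, Real.norm_of_nonneg (inv_nonneg.2 hδ.le), inv_mul_le_iff₀ hδ, mul_one]
  exact hx

/-- Factor-wise nets, with the covering error measured in any seminorm `p` relative to a bound for
`p` on admissible Kronecker products. -/
lemma exists_nets_kron {K : ℕ} (d d' r : Fin K → ℕ) {ε : ℝ} (hε : 0 < ε) :
    ∃ (N N' : Fin K → ℕ)
      (U : ∀ k, Fin (N k) → Matrix (Fin (d k)) (Fin (r k)) ℝ)
      (V : ∀ k, Fin (N' k) → Matrix (Fin (d' k)) (Fin (r k)) ℝ),
      (∀ k, (N k : ℝ) ≤ (1 + 4 / ε) ^ (d k * r k)) ∧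
      (∀ k, (N' k : ℝ) ≤ (1 + 4 / ε) ^ (d' k * r k)) ∧
      (∀ k j, ‖U k j‖ ≤ 1) ∧ (∀ k j', ‖V k j'‖ ≤ 1) ∧
      ∀ M : ∀ k, Matrix (Fin (d k)) (Fin (d' k)) ℝ,
        (∀ k, ‖M k‖ ≤ 1) → (∀ k, (M k).rank ≤ r k) →
        ∃ (j : ∀ k, Fin (N k)) (j' : ∀ k, Fin (N' k)),
          ∀ (p : Seminorm ℝ (Matrix (∀ k, Fin (d k)) (∀ k, Fin (d' k)) ℝ)) (S : ℝ),
            (∀ M : ∀ k, Matrix (Fin (d k)) (Fin (d' k)) ℝ,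
              (∀ k, ‖M k‖ ≤ 1) → (∀ k, (M k).rank ≤ r k) → p (kron M) ≤ S) →
            p (kron M - kron (fun k => U k (j k) * (V k (j' k))ᵀ)) ≤ K * (ε * S) := by
  choose N U hN hU hUnet using fun k => exists_net_unitBall_matrix (d k) (r k) hε
  choose N' V hN' hV hVnet using fun k => exists_net_unitBall_matrix (d' k) (r k) hε
  refine ⟨N, N', U, V, hN, hN', hU, hV, fun M hM hMr => ?_⟩
  choose P Q hP hQ hPQ using fun k => exists_mul_transpose_of_rank_le (M k) (hM k) (hMr k)
  choose j hj using fun k => hUnet k (P k) (hP k)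
  choose j' hj' using fun k => hVnet k (Q k) (hQ k)
  refine ⟨j, j', fun p S hS => seminorm_kron_sub_kron_le p _ _ fun C hC k => ?_⟩
  have hδ : 0 < ε / 2 := half_pos hε
  have hC1 : ∀ i, ‖C i‖ ≤ 1 ∧ (C i).rank ≤ r i := fun i => by
    rcases hC i with h | h <;> rw [h]
    · exact ⟨hM i, hMr i⟩
    · exact ⟨norm_mul_transpose_le_one (hU i _) (hV i _), rank_mul_transpose_le _ _⟩
  have hterm : ∀ (X : Matrix (Fin (d k)) (Fin (r k)) ℝ) (Y : Matrix (Fin (d' k)) (Fin (r k)) ℝ),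
      ‖X‖ ≤ 1 → ‖Y‖ ≤ 1 → p (kron (Function.update C k ((ε / 2) • (X * Yᵀ)))) ≤ ε / 2 * S := by
    intro X Y hX hY
    rw [kron_update_smul, map_smul_eq_mul, Real.norm_of_nonneg hδ.le]
    refine mul_le_mul_of_nonneg_left (hS _ (fun i => ?_) fun i => ?_) hδ.le
    all_goals
      rcases eq_or_ne i k with rfl | hi
      · rw [Function.update_self]
        first
        | exact norm_mul_transpose_le_one hX hY
        | exact rank_mul_transpose_le _ _
      · rw [Function.update_of_ne hi]
        first
        | exact (hC1 i).1
        | exact (hC1 i).2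
  have hsplit : M k - U k (j k) * (V k (j' k))ᵀ =
      (ε / 2) • (((ε / 2)⁻¹ • (P k - U k (j k))) * (Q k)ᵀ) +
        (ε / 2) • (U k (j k) * ((ε / 2)⁻¹ • (Q k - V k (j' k)))ᵀ) := by
    rw [Matrix.transpose_smul, Matrix.mul_smul, Matrix.smul_mul, smul_inv_smul₀ hδ.ne',
      smul_inv_smul₀ hδ.ne', hPQ k, Matrix.transpose_sub, Matrix.sub_mul, Matrix.mul_sub]
    abel
  rw [hsplit, kron_update_add]
  refine (map_add_le_add p _ _).trans ?_
  linarith [hterm _ _ (hU k (j k)) (norm_inv_smul_le_one hδ (hj' k)),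
    hterm _ _ (norm_inv_smul_le_one hδ (hj k)) (hQ k)]

/-- Factor-wise ε-nets for Kronecker products of low-rank spectral-norm-unit
matrices, with net sizes `(1+4/ε)^{d_k r_k}`, `(1+4/ε)^{d'_k r_k}` and covering error `ε·K`;
consequently (with `ε = 1/(8K)`) such nets can be chosen so that, for every linear map `f`
into a real normed space, the sup of `‖f(⊗_k M_k)‖` over admissible families is at most twice
the max of `‖f(⊗_k U_{j_k,k} V_{j'_k,k}ᵀ)‖` over net tuples. -/
theorem stmt5 {K : ℕ} (hK : 0 < K) (d d' r : Fin K → ℕ)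
    (hd : ∀ k, 0 < d k) (hd' : ∀ k, 0 < d' k) (hr : ∀ k, 0 < r k)
    (hrmin : ∀ k, r k ≤ min (d k) (d' k)) (ε : ℝ) (hε : 0 < ε) :
    (∃ (N N' : Fin K → ℕ)
        (U : ∀ k, Fin (N k) → Matrix (Fin (d k)) (Fin (r k)) ℝ)
        (V : ∀ k, Fin (N' k) → Matrix (Fin (d' k)) (Fin (r k)) ℝ),
        (∀ k, (N k : ℝ) ≤ (1 + 4 / ε) ^ (d k * r k)) ∧
        (∀ k, (N' k : ℝ) ≤ (1 + 4 / ε) ^ (d' k * r k)) ∧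
        (∀ k j, sNorm (U k j) ≤ 1) ∧ (∀ k j', sNorm (V k j') ≤ 1) ∧
        ∀ M : ∀ k, Matrix (Fin (d k)) (Fin (d' k)) ℝ,
          (∀ k, sNorm (M k) ≤ 1) → (∀ k, (M k).rank ≤ r k) →
          ∃ (j : ∀ k, Fin (N k)) (j' : ∀ k, Fin (N' k)),
            sNorm (kron M - kron (fun k => U k (j k) * (V k (j' k))ᵀ)) ≤ ε * K) ∧
    (∃ (N N' : Fin K → ℕ)
        (U : ∀ k, Fin (N k) → Matrix (Fin (d k)) (Fin (r k)) ℝ)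
        (V : ∀ k, Fin (N' k) → Matrix (Fin (d' k)) (Fin (r k)) ℝ),
        (∀ k, (N k : ℝ) ≤ (1 + 4 / (1 / (8 * (K : ℝ)))) ^ (d k * r k)) ∧
        (∀ k, (N' k : ℝ) ≤ (1 + 4 / (1 / (8 * (K : ℝ)))) ^ (d' k * r k)) ∧
        (∀ k j, sNorm (U k j) ≤ 1) ∧ (∀ k j', sNorm (V k j') ≤ 1) ∧
        ∀ (W : Type u) [NormedAddCommGroup W] [NormedSpace ℝ W]
          (f : Matrix (∀ k, Fin (d k)) (∀ k, Fin (d' k)) ℝ →ₗ[ℝ] W)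
          (M : ∀ k, Matrix (Fin (d k)) (Fin (d' k)) ℝ),
          (∀ k, sNorm (M k) ≤ 1) → (∀ k, (M k).rank ≤ r k) →
          ∃ (j : ∀ k, Fin (N k)) (j' : ∀ k, Fin (N' k)),
            ‖f (kron M)‖ ≤ 2 * ‖f (kron (fun k => U k (j k) * (V k (j' k))ᵀ))‖) := by
  constructor
  · obtain ⟨N, N', U, V, hN, hN', hU, hV, hnet⟩ := exists_nets_kron d d' r hε
    refine ⟨N, N', U, V, hN, hN', hU, hV, fun M hM hMr => ?_⟩
    obtain ⟨j, j', h⟩ := hnet M hM hMr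
    refine ⟨j, j', ?_⟩
    have := h (normSeminorm ℝ _) 1 fun M hM _ =>
      (norm_kron_le M).trans (Finset.prod_le_one (fun _ _ => norm_nonneg _) fun k _ => hM k)
    rw [mul_one, mul_comm] at this
    exact this
  · have hK' : (0 : ℝ) < K := Nat.cast_pos.2 hK
    obtain ⟨N, N', U, V, hN, hN', hU, hV, hnet⟩ :=
      exists_nets_kron d d' r (ε := 1 / (8 * (K : ℝ))) (by positivity)
    refine ⟨N, N', U, V, hN, hN', hU, hV, fun W _ _ f M hM hMr => ?_⟩
    let p : Seminorm ℝ (Matrix (∀ k, Fin (d k)) (∀ k, Fin (d' k)) ℝ) :=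
      (normSeminorm ℝ W).comp f
    let A : Set ℝ := {x | ∃ M : ∀ k, Matrix (Fin (d k)) (Fin (d' k)) ℝ,
      (∀ k, ‖M k‖ ≤ 1) ∧ (∀ k, (M k).rank ≤ r k) ∧ ‖f (kron M)‖ = x}
    have hbdd : BddAbove A := by
      refine ⟨‖LinearMap.toContinuousLinearMap f‖, ?_⟩
      rintro _ ⟨M, hM, -, rfl⟩
      refine (LinearMap.toContinuousLinearMap f).unit_le_opNorm _ ((norm_kron_le M).trans ?_)
      exact Finset.prod_le_one (fun _ _ => norm_nonneg _) fun k _ => hM k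
    have hS : ∀ M : ∀ k, Matrix (Fin (d k)) (Fin (d' k)) ℝ,
        (∀ k, ‖M k‖ ≤ 1) → (∀ k, (M k).rank ≤ r k) → p (kron M) ≤ sSup A :=
      fun M hM hMr => le_csSup hbdd ⟨M, hM, hMr, rfl⟩
    obtain ⟨j₀, j₀', -⟩ := hnet M hM hMr
    have : Nonempty ((∀ k, Fin (N k)) × (∀ k, Fin (N' k))) := ⟨(j₀, j₀')⟩
    obtain ⟨J, hJ⟩ := Finite.exists_max
      fun J : (∀ k, Fin (N k)) × (∀ k, Fin (N' k)) =>
        ‖f (kron fun k => U k (J.1 k) * (V k (J.2 k))ᵀ)‖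
    have hsup : sSup A ≤ sSup A / 8 + ‖f (kron fun k => U k (J.1 k) * (V k (J.2 k))ᵀ)‖ := by
      refine csSup_le ⟨_, M, hM, hMr, rfl⟩ ?_
      rintro _ ⟨M', hM', hMr', rfl⟩
      obtain ⟨j, j', h⟩ := hnet M' hM' hMr'
      have h1 : ‖f (kron M' - kron fun k => U k (j k) * (V k (j' k))ᵀ)‖ ≤ sSup A / 8 := by
        refine (h p _ hS).trans_eq ?_
        field_simp
      rw [map_sub] at h1
      linarith [hJ (j, j'), norm_le_norm_sub_add (f (kron M'))
        (f (kron fun k => U k (j k) * (V k (j' k))ᵀ))]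
    refine ⟨J.1, J.2, ?_⟩
    have hle : ‖f (kron M)‖ ≤ sSup A := hS M hM hMr
    linarith [norm_nonneg (f (kron fun k => U k (J.1 k) * (V k (J.2 k))ᵀ))]
end

section
/- Let H be a real inner product space and let γ, γ̂ ∈ H. (i) If ‖γ‖·‖γ̂‖ + ⟨γ, γ̂⟩ > 0, then the exact identity ‖γ‖·‖γ̂‖ − ⟨γ, γ̂⟩ = ( ‖γ‖²·‖γ̂ − γ‖² − ⟨γ, γ̂ − γ⟩² ) / ( ‖γ‖·‖γ̂‖ + ⟨γ, γ̂⟩ ) holds. (ii) If ‖γ − γ̂‖ ≤ ‖γ‖/2, then 0 ≤ ‖γ‖·‖γ̂‖ − ⟨γ, γ̂⟩ ≤ ‖γ − γ̂‖². -/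
open scoped RealInnerProductSpace

/-- Cauchy–Schwarz defect bound in a real inner product space:
(i) if `‖γ‖‖γ̂‖ + ⟪γ,γ̂⟫ > 0` then
`‖γ‖‖γ̂‖ − ⟪γ,γ̂⟫ = (‖γ‖²‖γ̂−γ‖² − ⟪γ,γ̂−γ⟫²)/(‖γ‖‖γ̂‖ + ⟪γ,γ̂⟫)`;
(ii) if `‖γ − γ̂‖ ≤ ‖γ‖/2` then `0 ≤ ‖γ‖‖γ̂‖ − ⟪γ,γ̂⟫ ≤ ‖γ − γ̂‖²`. -/
theorem stmt10 {H : Type*} [NormedAddCommGroup H] [InnerProductSpace ℝ H] (γ γh : H) :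
    (0 < ‖γ‖ * ‖γh‖ + ⟪γ, γh⟫ →
      ‖γ‖ * ‖γh‖ - ⟪γ, γh⟫ =
        (‖γ‖ ^ 2 * ‖γh - γ‖ ^ 2 - ⟪γ, γh - γ⟫ ^ 2) / (‖γ‖ * ‖γh‖ + ⟪γ, γh⟫)) ∧
    (‖γ - γh‖ ≤ ‖γ‖ / 2 →
      0 ≤ ‖γ‖ * ‖γh‖ - ⟪γ, γh⟫ ∧ ‖γ‖ * ‖γh‖ - ⟪γ, γh⟫ ≤ ‖γ - γh‖ ^ 2) := by
  have hsub : ‖γh - γ‖ ^ 2 = ‖γh‖ ^ 2 - 2 * ⟪γ, γh⟫ + ‖γ‖ ^ 2 := by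
    rw [norm_sub_sq_real, real_inner_comm]
  have hcs : ⟪γ, γh⟫ ≤ ‖γ‖ * ‖γh‖ := real_inner_le_norm γ γh
  refine ⟨fun hpos => ?_, fun _ => ⟨sub_nonneg.2 hcs, ?_⟩⟩
  · rw [eq_div_iff hpos.ne', hsub, inner_sub_right, real_inner_self_eq_norm_sq]
    ring
  · rw [norm_sub_rev, hsub]
    linarith [two_mul_le_add_sq ‖γ‖ ‖γh‖]
end

section
/- Let (E, 𝒜, μ) be a measure space, let p1, p2, q1, q2 : E → [0, ∞) be measurable with ∫ p1 dμ = ∫ p2 dμ = ∫ q1 dμ = ∫ q2 dμ = 1, and let π1, π2 ≥ 0 with π1 + π2 = 1. Define the Bayes risks R*_P = ∫ min(π1·p1, π2·p2) dμ and R*_Q = ∫ min(π1·q1, π2·q2) dμ. Then |R*_P − R*_Q| ≤ π1·(1/2)·∫ |p1 − q1| dμ + π2·(1/2)·∫ |q2 − p2| dμ. -/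
open MeasureTheory

/-- The linear terms on the right integrate to zero when the functions being compared have the
same integrals. -/
theorem min_sub_min_le_half_add_abs (a b c d : ℝ) :
    min a b - min c d ≤ (1 / 2) * (((a - c) + |a - c|) + ((b - d) + |d - b|)) := by
  rcases min_cases a b with ⟨h, _⟩ | ⟨h, _⟩ <;> rcases min_cases c d with ⟨h', _⟩ | ⟨h', _⟩ <;>
    rcases abs_cases (a - c) with ⟨h₁, _⟩ | ⟨h₁, _⟩ <;>
    rcases abs_cases (d - b) with ⟨h₂, _⟩ | ⟨h₂, _⟩ <;> rw [h, h', h₁, h₂] <;> linarith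

theorem integral_min_sub_integral_min_le {E : Type*} [MeasurableSpace E] {μ : Measure E}
    {a b c d : E → ℝ} (ha : Integrable a μ) (hb : Integrable b μ)
    (hc : Integrable c μ) (hd : Integrable d μ)
    (hac : ∫ x, a x ∂μ = ∫ x, c x ∂μ) (hbd : ∫ x, b x ∂μ = ∫ x, d x ∂μ) :
    (∫ x, min (a x) (b x) ∂μ) - ∫ x, min (c x) (d x) ∂μ ≤
      (1 / 2) * ((∫ x, |a x - c x| ∂μ) + ∫ x, |d x - b x| ∂μ) := by
  have hac' : Integrable (fun x => a x - c x) μ := ha.sub hc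
  have hbd' : Integrable (fun x => b x - d x) μ := hb.sub hd
  have hac_abs : Integrable (fun x => |a x - c x|) μ := hac'.abs
  have hdb_abs : Integrable (fun x => |d x - b x|) μ := (hd.sub hb).abs
  have hl : Integrable (fun x => (a x - c x) + |a x - c x|) μ := hac'.add hac_abs
  have hr : Integrable (fun x => (b x - d x) + |d x - b x|) μ := hbd'.add hdb_abs
  have hmin : Integrable (fun x => min (a x) (b x)) μ := ha.inf hb
  have hmin' : Integrable (fun x => min (c x) (d x)) μ := hc.inf hd
  calc (∫ x, min (a x) (b x) ∂μ) - ∫ x, min (c x) (d x) ∂μ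
      = ∫ x, (min (a x) (b x) - min (c x) (d x)) ∂μ := (integral_sub hmin hmin').symm
    _ ≤ ∫ x, (1 / 2) * (((a x - c x) + |a x - c x|) + ((b x - d x) + |d x - b x|)) ∂μ :=
        integral_mono (hmin.sub hmin') ((hl.add hr).const_mul _)
          fun x => min_sub_min_le_half_add_abs _ _ _ _
    _ = (1 / 2) * ((∫ x, |a x - c x| ∂μ) + ∫ x, |d x - b x| ∂μ) := by
        rw [integral_const_mul, integral_add hl hr, integral_add hac' hac_abs,
          integral_add hbd' hdb_abs, integral_sub ha hc, integral_sub hb hd, hac, hbd]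
        ring

/-- The Bayes risks under class-conditional densities `(p1, p2)` and
`(q1, q2)` with priors `(π1, π2)` differ by at most
`π1·(1/2)∫|p1 − q1| + π2·(1/2)∫|q2 − p2|`. -/
theorem stmt13 {E : Type*} [MeasurableSpace E] (μ : Measure E)
    (p1 p2 q1 q2 : E → ℝ)
    (hp1m : Measurable p1) (hp2m : Measurable p2)
    (hq1m : Measurable q1) (hq2m : Measurable q2)
    (hp1 : ∀ x, 0 ≤ p1 x) (hp2 : ∀ x, 0 ≤ p2 x)
    (hq1 : ∀ x, 0 ≤ q1 x) (hq2 : ∀ x, 0 ≤ q2 x)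
    (hp1i : ∫ x, p1 x ∂μ = 1) (hp2i : ∫ x, p2 x ∂μ = 1)
    (hq1i : ∫ x, q1 x ∂μ = 1) (hq2i : ∫ x, q2 x ∂μ = 1)
    (π1 π2 : ℝ) (hπ1 : 0 ≤ π1) (hπ2 : 0 ≤ π2) (hπ : π1 + π2 = 1) :
    |(∫ x, min (π1 * p1 x) (π2 * p2 x) ∂μ) - ∫ x, min (π1 * q1 x) (π2 * q2 x) ∂μ| ≤
      π1 * ((1 / 2) * ∫ x, |p1 x - q1 x| ∂μ) +
        π2 * ((1 / 2) * ∫ x, |q2 x - p2 x| ∂μ) := by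
  have integrable_of_integral_eq_one {f : E → ℝ} (h : ∫ x, f x ∂μ = 1) : Integrable f μ :=
    .of_integral_ne_zero (by rw [h]; exact one_ne_zero)
  have ip1 := (integrable_of_integral_eq_one hp1i).const_mul π1
  have ip2 := (integrable_of_integral_eq_one hp2i).const_mul π2
  have iq1 := (integrable_of_integral_eq_one hq1i).const_mul π1
  have iq2 := (integrable_of_integral_eq_one hq2i).const_mul π2
  have e1 : ∫ x, π1 * p1 x ∂μ = ∫ x, π1 * q1 x ∂μ := by
    simp only [integral_const_mul, hp1i, hq1i]
  have e2 : ∫ x, π2 * p2 x ∂μ = ∫ x, π2 * q2 x ∂μ := by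
    simp only [integral_const_mul, hp2i, hq2i]
  have scale {r : ℝ} (hr : 0 ≤ r) (f g : E → ℝ) :
      ∫ x, |r * f x - r * g x| ∂μ = r * ∫ x, |f x - g x| ∂μ := by
    simp only [← mul_sub, abs_mul, abs_of_nonneg hr, integral_const_mul]
  have hPQ := integral_min_sub_integral_min_le ip1 ip2 iq1 iq2 e1 e2
  have hQP := integral_min_sub_integral_min_le iq1 iq2 ip1 ip2 e1.symm e2.symm
  rw [scale hπ1, scale hπ2] at hPQ hQP
  simp only [abs_sub_comm (q1 _), abs_sub_comm (p2 _)] at hPQ hQP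
  rw [abs_le]
  constructor <;> linarith
end

section
/- Let π0, π1 ≥ 0 with π0 + π1 = 1, let a ∈ ℝ, and define f : ℝ → ℝ by f(μ) = π0·Φ(a − μ) + π1·Φ(−a − μ), where Φ is the standard normal CDF. Then: (i) f is differentiable with f'(μ) = −π0·φ(a − μ) − π1·φ(−a − μ) < 0 for all μ, so f is strictly decreasing on ℝ; (ii) f is convex on [|a|, ∞); and (iii) for all μ_R, μ* with |a| ≤ μ_R ≤ μ*, f(μ_R) − f(μ*) ≤ (μ* − μ_R)·φ(μ_R − |a|) ≤ (2π)^{-1/2}·(μ* − μ_R)·exp(−(μ_R − |a|)²/2). -/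
/-- Density of the standard normal distribution: `φ(u) = (2π)^{-1/2} e^{−u²/2}`. -/
noncomputable def stdNormalPDF (u : ℝ) : ℝ :=
  (Real.sqrt (2 * Real.pi))⁻¹ * Real.exp (-u ^ 2 / 2)

/-- Cumulative distribution function of the standard normal distribution:
`Φ(x) = ∫_{−∞}^{x} (2π)^{-1/2} e^{−u²/2} du`. -/
noncomputable def stdNormalCDF (x : ℝ) : ℝ :=
  ∫ u in Set.Iic x, stdNormalPDF u

theorem stdNormalPDF_pos (u : ℝ) : 0 < stdNormalPDF u := by
  unfold stdNormalPDF
  positivity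

theorem continuous_stdNormalPDF : Continuous stdNormalPDF := by
  unfold stdNormalPDF
  fun_prop

theorem integrable_stdNormalPDF : MeasureTheory.Integrable stdNormalPDF := by
  unfold stdNormalPDF
  refine MeasureTheory.Integrable.const_mul ?_ _
  convert integrable_exp_neg_mul_sq (b := 1 / 2) (by norm_num) using 3 with u
  ring

theorem stdNormalPDF_le_of_abs_le {u v : ℝ} (h : |v| ≤ |u|) :
    stdNormalPDF u ≤ stdNormalPDF v := by
  have := sq_le_sq.mpr h
  unfold stdNormalPDF
  gcongr

theorem hasDerivAt_stdNormalCDF (x : ℝ) : HasDerivAt stdNormalCDF (stdNormalPDF x) x := by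
  have hcdf : stdNormalCDF = fun y => stdNormalCDF 0 + ∫ u in (0 : ℝ)..y, stdNormalPDF u := by
    funext y
    rw [← intervalIntegral.integral_Iic_sub_Iic integrable_stdNormalPDF.integrableOn
      integrable_stdNormalPDF.integrableOn]
    simp [stdNormalCDF]
  rw [hcdf]
  exact (continuous_stdNormalPDF.integral_hasStrictDerivAt 0 x).hasDerivAt.const_add _

/-- For `f(μ) = π₀ Φ(a − μ) + π₁ Φ(−a − μ)`:
(i) `f` is differentiable with `f'(μ) = −π₀ φ(a − μ) − π₁ φ(−a − μ) < 0`, so `f` is strictly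
decreasing; (ii) `f` is convex on `[|a|, ∞)`; (iii) for `|a| ≤ μ_R ≤ μ*`,
`f(μ_R) − f(μ*) ≤ (μ* − μ_R) φ(μ_R − |a|) ≤ (2π)^{-1/2} (μ* − μ_R) exp(−(μ_R − |a|)²/2)`. -/
theorem stmt14 (π0 π1 : ℝ) (hπ0 : 0 ≤ π0) (hπ1 : 0 ≤ π1) (hπ : π0 + π1 = 1) (a : ℝ) :
    (∀ μ : ℝ, HasDerivAt (fun x : ℝ => π0 * stdNormalCDF (a - x) + π1 * stdNormalCDF (-a - x))
        (-(π0 * stdNormalPDF (a - μ)) - π1 * stdNormalPDF (-a - μ)) μ) ∧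
    (∀ μ : ℝ, -(π0 * stdNormalPDF (a - μ)) - π1 * stdNormalPDF (-a - μ) < 0) ∧
    StrictAnti (fun x : ℝ => π0 * stdNormalCDF (a - x) + π1 * stdNormalCDF (-a - x)) ∧
    ConvexOn ℝ (Set.Ici |a|)
      (fun x : ℝ => π0 * stdNormalCDF (a - x) + π1 * stdNormalCDF (-a - x)) ∧
    (∀ μR μs : ℝ, |a| ≤ μR → μR ≤ μs →
      (π0 * stdNormalCDF (a - μR) + π1 * stdNormalCDF (-a - μR)) -
          (π0 * stdNormalCDF (a - μs) + π1 * stdNormalCDF (-a - μs)) ≤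
        (μs - μR) * stdNormalPDF (μR - |a|) ∧
      (μs - μR) * stdNormalPDF (μR - |a|) ≤
        (Real.sqrt (2 * Real.pi))⁻¹ * (μs - μR) * Real.exp (-(μR - |a|) ^ 2 / 2)) := by
  have hderiv : ∀ μ : ℝ,
      HasDerivAt (fun x : ℝ => π0 * stdNormalCDF (a - x) + π1 * stdNormalCDF (-a - x))
        (-(π0 * stdNormalPDF (a - μ)) - π1 * stdNormalPDF (-a - μ)) μ := by
    intro μ
    have hcomp (b : ℝ) : HasDerivAt (fun x => stdNormalCDF (b - x)) (-stdNormalPDF (b - μ)) μ :=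
      (hasDerivAt_stdNormalCDF (b - μ)).comp_const_sub b μ
    exact (((hcomp a).const_mul π0).add ((hcomp (-a)).const_mul π1)).congr_deriv (by ring)
  have hneg : ∀ μ : ℝ, -(π0 * stdNormalPDF (a - μ)) - π1 * stdNormalPDF (-a - μ) < 0 := by
    intro μ
    have h0 := stdNormalPDF_pos (a - μ)
    have h1 := stdNormalPDF_pos (-a - μ)
    rcases hπ0.eq_or_lt with h | h
    · obtain rfl : π1 = 1 := by linarith
      simp [← h, h1]
    · have := mul_pos h h0
      have := mul_nonneg hπ1 h1.le
      linarith
  have hanti {b x y : ℝ} (hb : b ≤ x) (hxy : x ≤ y) :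
      stdNormalPDF (b - y) ≤ stdNormalPDF (b - x) := by
    apply stdNormalPDF_le_of_abs_le
    rw [abs_of_nonpos (by linarith), abs_of_nonpos (by linarith)]
    linarith
  have hle {b x y : ℝ} (hb : b ≤ |a|) (hx : |a| ≤ x) (hxy : x ≤ y) :
      stdNormalPDF (b - y) ≤ stdNormalPDF (x - |a|) := by
    apply stdNormalPDF_le_of_abs_le
    rw [abs_of_nonneg (by linarith), abs_of_nonpos (a := b - y) (by linarith)]
    linarith
  have hdiff : Differentiable ℝ
      (fun x : ℝ => π0 * stdNormalCDF (a - x) + π1 * stdNormalCDF (-a - x)) :=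
    fun μ => (hderiv μ).differentiableAt
  refine ⟨hderiv, hneg, strictAnti_of_deriv_neg fun μ => ?_, ?_, fun μR μs hR hs => ⟨?_, ?_⟩⟩
  · rw [(hderiv μ).deriv]
    exact hneg μ
  · refine MonotoneOn.convexOn_of_deriv (convex_Ici _) hdiff.continuous.continuousOn
      hdiff.differentiableOn fun x hx y _ hxy => ?_
    have hx : |a| ≤ x := interior_subset hx
    rw [(hderiv x).deriv, (hderiv y).deriv]
    have h0 := mul_le_mul_of_nonneg_left (hanti ((le_abs_self a).trans hx) hxy) hπ0
    have h1 := mul_le_mul_of_nonneg_left (hanti ((neg_le_abs a).trans hx) hxy) hπ1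
    linarith
  · have hmvt := (convex_Icc μR μs).mul_sub_le_image_sub_of_le_deriv
      hdiff.continuous.continuousOn hdiff.differentiableOn
      (C := -stdNormalPDF (μR - |a|)) (fun x hx => by
        have hx : μR ≤ x := (interior_subset hx).1
        rw [(hderiv x).deriv]
        have h0 := mul_le_mul_of_nonneg_left (hle (le_abs_self a) hR hx) hπ0
        have h1 := mul_le_mul_of_nonneg_left (hle (neg_le_abs a) hR hx) hπ1
        have hsum : π0 * stdNormalPDF (μR - |a|) + π1 * stdNormalPDF (μR - |a|)
            = stdNormalPDF (μR - |a|) := by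
          rw [← add_mul, hπ, one_mul]
        linarith) μR (Set.left_mem_Icc.mpr hs) μs (Set.right_mem_Icc.mpr hs) hs
    linarith
  · unfold stdNormalPDF
    exact le_of_eq (by ring)
end

section
/- Let ι be a finite index type, and let A1, A0 ⊆ ι be disjoint sets with A1 ∪ A0 = ι. Let v, t : (A1 → ℝ) → (A0 → ℝ) be continuously differentiable maps. Define the affine coupling map g : (ι → ℝ) → (ι → ℝ) by g(x)(j) = x(j) for j ∈ A1, and g(x)(j) = x(j)·exp( v(x|_{A1})(j) ) + t(x|_{A1})(j) for j ∈ A0, where x|_{A1} denotes the restriction of x to A1. Then g is differentiable, g is a bijection of (ι → ℝ) onto itself, and for every x the determinant of the Fréchet derivative of g at x equals exp( Σ_{j ∈ A0} v(x|_{A1})(j) ); in particular this determinant is strictly positive. -/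
/-- The derivative of one transformed coordinate of an affine coupling: up to a linear map that
factors through the conditioning variables, it is the coordinate scaled by `exp a`. -/
theorem exists_hasFDerivAt_mul_exp_comp_add {E F : Type*}
    [NormedAddCommGroup E] [NormedSpace ℝ E] [NormedAddCommGroup F] [NormedSpace ℝ F]
    {a b : F → ℝ} (l : E →L[ℝ] ℝ) (r : E →L[ℝ] F) (x : E)
    (ha : DifferentiableAt ℝ a (r x)) (hb : DifferentiableAt ℝ b (r x)) :
    ∃ B : F →L[ℝ] ℝ, HasFDerivAt (fun y => l y * Real.exp (a (r y)) + b (r y))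
      (Real.exp (a (r x)) • l + B.comp r) x := by
  have h1 := ((ha.hasFDerivAt.comp x r.hasFDerivAt).exp)
  have h2 := hb.hasFDerivAt.comp x r.hasFDerivAt
  refine ⟨(l x * Real.exp (a (r x))) • fderiv ℝ a (r x) + fderiv ℝ b (r x),
    ((l.hasFDerivAt.mul h1).add h2).congr_fderiv ?_⟩
  ext w
  simp
  ring


/-- The affine-coupling (RealNVP) map `g` with mask `A1/A0` and `C¹`
conditioners `v, t` — `g(x)_j = x_j` for `j ∈ A1` and
`g(x)_j = x_j · exp(v(x|_{A1})_j) + t(x|_{A1})_j` for `j ∈ A0` — is differentiable, is a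
bijection of `ι → ℝ` onto itself, and its Jacobian determinant at every `x` equals
`exp(Σ_{j ∈ A0} v(x|_{A1})_j)`; in particular the Jacobian determinant is strictly positive. -/
theorem stmt16 {ι : Type*} [Fintype ι]
    (A1 A0 : Set ι) [DecidablePred (· ∈ A1)] [DecidablePred (· ∈ A0)]
    (hdisj : Disjoint A1 A0) (hunion : A1 ∪ A0 = Set.univ)
    (v t : (↥A1 → ℝ) → (↥A0 → ℝ))
    (hv : ContDiff ℝ 1 v) (ht : ContDiff ℝ 1 t)
    (g : (ι → ℝ) → (ι → ℝ))
    (hg : ∀ (x : ι → ℝ) (j : ι), g x j =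
      if h : j ∈ A0 then
        x j * Real.exp (v (fun i => x i.1) ⟨j, h⟩) + t (fun i => x i.1) ⟨j, h⟩
      else x j) :
    Differentiable ℝ g ∧ Function.Bijective g ∧
    ∀ x : ι → ℝ,
      LinearMap.det ((fderiv ℝ g x : (ι → ℝ) →L[ℝ] (ι → ℝ)) : (ι → ℝ) →ₗ[ℝ] (ι → ℝ)) =
          Real.exp (∑ j : ↥A0, v (fun i => x i.1) j) ∧
        0 < LinearMap.det
          ((fderiv ℝ g x : (ι → ℝ) →L[ℝ] (ι → ℝ)) : (ι → ℝ) →ₗ[ℝ] (ι → ℝ)) := by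
  classical
  have hmem : ∀ {i}, i ∈ A1 → i ∉ A0 := fun h h' => Set.disjoint_left.mp hdisj h h'
  have hg1 : ∀ x j, j ∉ A0 → g x j = x j := fun x j h => by rw [hg, dif_neg h]
  have hg0 : ∀ x (j : A0), g x j =
      x j * Real.exp (v (fun i => x i.1) j) + t (fun i => x i.1) j :=
    fun x j => by rw [hg, dif_pos j.2]
  let r : (ι → ℝ) →L[ℝ] (A1 → ℝ) := ContinuousLinearMap.pi fun i => .proj i.1
  have hcoord0 : ∀ x (j : A0), ∃ B : (A1 → ℝ) →L[ℝ] ℝ, HasFDerivAt (fun y => g y j)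
      (Real.exp (v (r x) j) • ContinuousLinearMap.proj (R := ℝ) (φ := fun _ : ι => ℝ) j.1
        + B.comp r) x := fun x j => by
    have hvj := differentiableAt_pi.mp (hv.differentiable one_ne_zero (r x)) j
    have htj := differentiableAt_pi.mp (ht.differentiable one_ne_zero (r x)) j
    obtain ⟨B, hB⟩ := exists_hasFDerivAt_mul_exp_comp_add
      (ContinuousLinearMap.proj (R := ℝ) (φ := fun _ : ι => ℝ) j.1) r x hvj htj
    exact ⟨B, hB.congr_of_eventuallyEq (.of_forall fun y => hg0 y j)⟩
  have hcoord1 : ∀ x j, j ∉ A0 → HasFDerivAt (fun y => g y j)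
      (ContinuousLinearMap.proj (R := ℝ) (φ := fun _ : ι => ℝ) j) x := fun x j hj =>
    (ContinuousLinearMap.proj (R := ℝ) (φ := fun _ : ι => ℝ) j).hasFDerivAt.congr_of_eventuallyEq
      (.of_forall fun y => hg1 y j hj)
  have hdiff : Differentiable ℝ g := fun x => differentiableAt_pi.mpr fun j => by
    by_cases hj : j ∈ A0
    · obtain ⟨B, hB⟩ := hcoord0 x ⟨j, hj⟩
      exact hB.differentiableAt
    · exact (hcoord1 x j hj).differentiableAt
  have happly : ∀ x w j, fderiv ℝ g x w j = fderiv ℝ (fun y => g y j) x w := fun x w j => by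
    rw [fderiv_apply (hdiff x) j]
    rfl
  have hdet : ∀ x, LinearMap.det (fderiv ℝ g x : (ι → ℝ) →ₗ[ℝ] (ι → ℝ)) =
      Real.exp (∑ j : A0, v (fun i => x i.1) j) := fun x => by
    rw [← LinearMap.det_toMatrix', Matrix.twoBlockTriangular_det _ (· ∈ A0)]
    · have h0 : Matrix.toSquareBlockProp
          (LinearMap.toMatrix' (fderiv ℝ g x : (ι → ℝ) →ₗ[ℝ] (ι → ℝ))) (· ∈ A0) =
          Matrix.diagonal fun j : A0 => Real.exp (v (r x) j) := by
        ext i j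
        have hr : r (Pi.single j.1 1) = 0 := by
          ext k
          exact Pi.single_eq_of_ne (fun h : k.1 = j.1 => hmem k.2 (h ▸ j.2)) _
        obtain ⟨B, hB⟩ := hcoord0 x i
        simp [Matrix.toSquareBlockProp_def, LinearMap.toMatrix'_apply, happly, hB.fderiv, hr,
          Matrix.diagonal_apply, Pi.single_apply, Subtype.ext_iff]
      have h1 : Matrix.toSquareBlockProp
          (LinearMap.toMatrix' (fderiv ℝ g x : (ι → ℝ) →ₗ[ℝ] (ι → ℝ))) (¬ · ∈ A0) = 1 := by
        ext i j
        simp [Matrix.toSquareBlockProp_def, LinearMap.toMatrix'_apply, happly,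
          (hcoord1 x i i.2).fderiv, Matrix.one_apply, Pi.single_apply, Subtype.ext_iff]
      rw [h0, h1, Matrix.det_one, mul_one, Real.exp_sum]
      exact Matrix.det_diagonal
    · intro i hi j hj
      have hij : i ≠ j := fun h => hi (h ▸ hj)
      simp [LinearMap.toMatrix'_apply, happly, (hcoord1 x i hi).fderiv, hij]
  refine ⟨hdiff, ⟨fun x y hxy => ?_, fun y => ?_⟩, fun x => ⟨hdet x, hdet x ▸ Real.exp_pos _⟩⟩
  · have hr : (fun i : A1 => x i.1) = fun i => y i.1 := by
      ext i
      rw [← hg1 x i (hmem i.2), hxy, hg1 y i (hmem i.2)]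
    ext j
    by_cases hj : j ∈ A0
    · have h := congrFun hxy j
      rw [hg0 x ⟨j, hj⟩, hg0 y ⟨j, hj⟩, hr] at h
      exact mul_right_cancel₀ (Real.exp_ne_zero _) (add_right_cancel h)
    · rw [← hg1 x j hj, hxy, hg1 y j hj]
  · let x : ι → ℝ := fun j => if h : j ∈ A0 then
      (y j - t (fun i => y i.1) ⟨j, h⟩) / Real.exp (v (fun i => y i.1) ⟨j, h⟩) else y j
    have hr : (fun i : A1 => x i.1) = fun i => y i.1 := by
      ext i
      exact dif_neg (hmem i.2)
    refine ⟨x, funext fun j => ?_⟩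
    by_cases hj : j ∈ A0
    · rw [hg0 x ⟨j, hj⟩, hr]
      simp [x, hj]
    · rw [hg1 x j hj]
      exact dif_neg hj
end

section
/- Let m ≥ 8 be an integer. Then there exists a subset S of the binary hypercube {0, 1}^m (equivalently, of functions from {1, …, m} to {0, 1}) such that: the all-zeros sequence belongs to S; |S| ≥ 2^{m/8} + 1; and for any two distinct elements ω, ω' ∈ S, the Hamming distance ρ_H(ω, ω') = #{ i : ω_i ≠ ω'_i } satisfies ρ_H(ω, ω') ≥ m/8. -/
/-- The generating function of the Hamming distance to a fixed binary sequence. -/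
theorem sum_pow_hammingDist_bool {ι : Type*} [Fintype ι] [DecidableEq ι] (x : ℝ) (s : ι → Bool) :
    ∑ w : ι → Bool, x ^ hammingDist w s = (1 + x) ^ Fintype.card ι := by
  have hprod (w : ι → Bool) :
      x ^ hammingDist w s = ∏ i, if w i ≠ s i then x else 1 := by
    rw [hammingDist, ← Finset.prod_const, Finset.prod_filter]
  have hsum (i : ι) : ∑ b : Bool, (if b ≠ s i then x else 1) = 1 + x := by
    cases s i <;> simp [add_comm]
  simp_rw [hprod]
  rw [← Fintype.piFinset_univ,
    ← Finset.prod_univ_sum (fun _ => Finset.univ) (fun i b => if b ≠ s i then x else 1)]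
  simp_rw [hsum, Finset.prod_const, Finset.card_univ]

/-- A maximal separated set containing a given point is a covering set. -/
theorem exists_separated_covering {α : Type*} [Fintype α] (a : α) (r : α → α → Prop)
    (hr : ∀ x, r x x) (hsymm : ∀ x y, r x y → r y x) :
    ∃ S : Finset α, a ∈ S ∧ (∀ x ∈ S, ∀ y ∈ S, x ≠ y → ¬ r x y) ∧ ∀ x, ∃ y ∈ S, r x y := by
  classical
  let F : Finset (Finset α) :=
    Finset.univ.filter fun S => a ∈ S ∧ ∀ x ∈ S, ∀ y ∈ S, x ≠ y → ¬ r x y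
  have hF : F.Nonempty := ⟨{a}, by simp [F]⟩
  obtain ⟨S, hS, hmax⟩ := F.exists_max_image Finset.card hF
  obtain ⟨haS, hsep⟩ := (Finset.mem_filter.mp hS).2
  refine ⟨S, haS, hsep, fun x => ?_⟩
  by_contra! hx
  have hxS : x ∉ S := fun h => hx x h (hr x)
  have hins : insert x S ∈ F := by
    refine Finset.mem_filter.mpr ⟨Finset.mem_univ _, Finset.mem_insert_of_mem haS, ?_⟩
    intro u hu v hv huv
    rcases Finset.mem_insert.mp hu with rfl | huS <;> rcases Finset.mem_insert.mp hv with rfl | hvS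
    · exact absurd rfl huv
    · exact hx v hvS
    · exact fun h => hx u huS (hsymm _ _ h)
    · exact hsep u huS v hvS huv
  have hcard := hmax _ hins
  rw [Finset.card_insert_of_notMem hxS] at hcard
  omega

/-- **Varshamov–Gilbert bound.** For `m ≥ 8` there is a set `S` of binary
sequences of length `m` containing the all-zeros sequence, of cardinality at least
`2^{m/8} + 1`, whose distinct elements are pairwise at Hamming distance at least `m/8`. -/
theorem stmt19 {m : ℕ} (hm : 8 ≤ m) :
    ∃ S : Finset (Fin m → Bool),
      (fun _ => false) ∈ S ∧
      (2 : ℝ) ^ ((m : ℝ) / 8) + 1 ≤ (S.card : ℝ) ∧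
      ∀ ω ∈ S, ∀ ω' ∈ S, ω ≠ ω' → (m : ℝ) / 8 ≤ (hammingDist ω ω' : ℝ) := by
  obtain ⟨S, h0, hsep, hcov⟩ := exists_separated_covering (fun _ : Fin m => false)
    (fun w s => (hammingDist w s : ℝ) < (m : ℝ) / 8)
    (fun w => by rw [hammingDist_self]; push_cast; positivity)
    (fun w s h => by rwa [hammingDist_comm])
  refine ⟨S, h0, ?_, fun w hw s hs hne => not_lt.mp (hsep w hw s hs hne)⟩
  set y : ℝ := (2 : ℝ) ^ ((m : ℝ) / 8) with hy
  have hy1 : 1 ≤ y := Real.one_le_rpow (by norm_num) (by positivity)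
  have hy8 : y ^ 8 = 2 ^ m := by
    rw [hy, ← Real.rpow_natCast, ← Real.rpow_mul (by norm_num), ← Real.rpow_natCast]
    congr 1
    push_cast
    ring
  have hnear (w s : Fin m → Bool) (h : (hammingDist w s : ℝ) < (m : ℝ) / 8) :
      1 ≤ y ^ 3 * (1 / 8 : ℝ) ^ hammingDist w s := by
    have h2 : (2 : ℝ) ^ hammingDist w s ≤ y := by
      rw [← Real.rpow_natCast]
      exact Real.rpow_le_rpow_of_exponent_le (by norm_num) h.le
    calc (1 : ℝ) = (2 ^ hammingDist w s) ^ 3 * (1 / 8 : ℝ) ^ hammingDist w s := by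
          rw [← pow_mul, mul_comm _ 3, pow_mul, ← mul_pow]
          norm_num
      _ ≤ _ := by gcongr
  have hcount : (2 : ℝ) ^ m ≤ S.card * (y ^ 3 * (9 / 8) ^ m) := by
    calc (2 : ℝ) ^ m = ∑ _w : Fin m → Bool, (1 : ℝ) := by simp
      _ ≤ ∑ w : Fin m → Bool, ∑ s ∈ S, y ^ 3 * (1 / 8 : ℝ) ^ hammingDist w s := by
          refine Finset.sum_le_sum fun w _ => ?_
          obtain ⟨s, hs, hws⟩ := hcov w
          exact (hnear w s hws).trans (Finset.single_le_sum
            (f := fun s => y ^ 3 * (1 / 8 : ℝ) ^ hammingDist w s)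
            (fun _ _ => by positivity) hs)
      _ = S.card * (y ^ 3 * (9 / 8) ^ m) := by
          rw [Finset.sum_comm]
          simp_rw [← Finset.mul_sum, sum_pow_hammingDist_bool]
          norm_num
          ring
  have hgrow : 2 * (9 / 8 : ℝ) ^ m ≤ y ^ 4 := by
    refine (sq_le_sq₀ (by positivity) (by positivity)).mp ?_
    have h4 : (4 : ℝ) ≤ (128 / 81) ^ m :=
      le_trans (by norm_num) (pow_le_pow_right₀ (by norm_num : (1 : ℝ) ≤ 128 / 81) hm)
    calc (2 * (9 / 8 : ℝ) ^ m) ^ 2 = 4 * (81 / 64) ^ m := by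
          rw [mul_pow, ← pow_mul, mul_comm m 2, pow_mul]
          norm_num
      _ ≤ (128 / 81) ^ m * (81 / 64) ^ m := by gcongr
      _ = (y ^ 4) ^ 2 := by
          rw [← mul_pow, ← pow_mul, hy8]
          norm_num
  have hmul : 2 * y * (y ^ 3 * (9 / 8) ^ m) ≤ S.card * (y ^ 3 * (9 / 8) ^ m) := by
    calc 2 * y * (y ^ 3 * (9 / 8) ^ m) = y ^ 4 * (2 * (9 / 8) ^ m) := by ring
      _ ≤ y ^ 4 * y ^ 4 := by gcongr
      _ = 2 ^ m := by rw [← hy8]; ring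
      _ ≤ _ := hcount
  have := le_of_mul_le_mul_right hmul (by positivity)
  linarith
end
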